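/- arXiv:1707.01931 — 2 statements merged into one kernel-verified Lean document; each statement's English description precedes it below -/
import Mathlib

section
/- Let μ be the unique real root of 31μ³ + 62μ² + 71μ − 27 (μ ≈ 0.2938198) and let σ > 0 be the unique positive real root of 29791σ⁶ − 59582σ⁴ + 298411σ² − 159099 (σ² ≈ 0.5809694). Then the cumulative size of catastrophes of a uniformly random Dyck path with catastrophes of length n is asymptotically Gaussian: for every real x, the fraction of Dyck paths with catastrophes of length n whose cumulative size of catastrophes is at most μn + σ√n·x tends, as n → ∞, to Φ(x) = (2π)^{−1/2} ∫_{−∞}^{x} e^{−t²/2} dt. -/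
open Filter Topology

/-- Validity of a path with catastrophes over the jump set `J`, starting from
altitude `h`: each step is either a jump `s ∈ J` keeping the altitude
nonnegative, or a catastrophe `s = -h` from an altitude `h > 0` with `-h ∉ J`
(landing at altitude `0`). -/
def CatValidFrom (J : Finset ℤ) : ℤ → List ℤ → Prop
  | _, [] => True
  | h, s :: r =>
    ((s ∈ J ∧ 0 ≤ h + s) ∨ (s = -h ∧ 0 < h ∧ -h ∉ J)) ∧ CatValidFrom J (h + s) r

/-- The cumulative size of catastrophes of a path starting at altitude `h`:
the sum of the altitudes from which the catastrophes of the path occur. -/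
def catSizeSum (J : Finset ℤ) : ℤ → List ℤ → ℤ
  | _, [] => 0
  | h, s :: r => (if s = -h ∧ 0 < h ∧ -h ∉ J then h else 0) + catSizeSum J (h + s) r

/-- The jump set of Dyck paths. For this jump set a catastrophe is a jump
`-h` from an altitude `h ≥ 2` to altitude `0`. -/
def dyckJ : Finset ℤ := {-1, 1}

/-- `l` is a Dyck path with catastrophes of length `n`. -/
def DyckCat (n : ℕ) (l : List ℤ) : Prop :=
  l.length = n ∧ CatValidFrom dyckJ 0 l ∧ l.sum = 0

/-- The number `e n` of Dyck paths with catastrophes of length `n`. -/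
noncomputable def eCount (n : ℕ) : ℕ := Nat.card {l : List ℤ // DyckCat n l}

/-- The standard Gaussian cumulative distribution function
`Φ(x) = (2π)^{-1/2} ∫_{-∞}^{x} e^{-t²/2} dt`. -/
noncomputable def gaussianCDF (x : ℝ) : ℝ :=
  (Real.sqrt (2 * Real.pi))⁻¹ * ∫ t in Set.Iic x, Real.exp (-t ^ 2 / 2)

/-- The paths with catastrophes of length `n` from altitude `h` to altitude `0`. -/
def catPaths : ℕ → ℕ → Finset (List ℤ)
  | 0, h => if h = 0 then {[]} else ∅
  | n + 1, h =>
    (catPaths n (h + 1)).image (List.cons 1) ∪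
      ((if 1 ≤ h then (catPaths n (h - 1)).image (List.cons (-1)) else ∅) ∪
        (if 2 ≤ h then (catPaths n 0).image (List.cons (-(h : ℤ))) else ∅))

lemma mem_dyckJ (s : ℤ) : s ∈ dyckJ ↔ s = -1 ∨ s = 1 := by
  simp [dyckJ]

lemma mem_catPaths (n h : ℕ) (l : List ℤ) :
    l ∈ catPaths n h ↔ l.length = n ∧ CatValidFrom dyckJ h l ∧ (h : ℤ) + l.sum = 0 := by
  induction n generalizing h l with
  | zero =>
    cases l with
    | nil => by_cases hh : h = 0 <;> simp [catPaths, hh, CatValidFrom]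
    | cons a l => by_cases hh : h = 0 <;> simp [catPaths, hh]
  | succ n ih =>
    cases l with
    | nil => simp [catPaths]; split_ifs <;> simp
    | cons s l =>
      have key : s :: l ∈ catPaths (n + 1) h ↔
          (s = 1 ∧ l ∈ catPaths n (h + 1)) ∨ (1 ≤ h ∧ s = -1 ∧ l ∈ catPaths n (h - 1)) ∨
            (2 ≤ h ∧ s = -(h : ℤ) ∧ l ∈ catPaths n 0) := by
        simp only [catPaths, Finset.mem_union, Finset.mem_image, List.cons.injEq]
        refine or_congr ?_ (or_congr ?_ ?_)
        · constructor
          · rintro ⟨a, ha, rfl, rfl⟩; exact ⟨rfl, ha⟩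
          · rintro ⟨rfl, ha⟩; exact ⟨l, ha, rfl, rfl⟩
        · split_ifs with hh
          · simp only [Finset.mem_image, List.cons.injEq, hh, true_and]
            constructor
            · rintro ⟨a, ha, rfl, rfl⟩; exact ⟨rfl, ha⟩
            · rintro ⟨rfl, ha⟩; exact ⟨l, ha, rfl, rfl⟩
          · simp [hh]
        · split_ifs with hh
          · simp only [Finset.mem_image, List.cons.injEq, hh, true_and]
            constructor
            · rintro ⟨a, ha, rfl, rfl⟩; exact ⟨rfl, ha⟩
            · rintro ⟨rfl, ha⟩; exact ⟨l, ha, rfl, rfl⟩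
          · simp [hh]
      rw [key, ih, ih, ih]
      simp only [CatValidFrom, mem_dyckJ, List.length_cons, List.sum_cons, Nat.add_right_cancel_iff]
      constructor
      · rintro (⟨rfl, h1, h2, h3⟩ | ⟨hh, rfl, h1, h2, h3⟩ | ⟨hh, rfl, h1, h2, h3⟩)
        · push_cast at h2 h3
          exact ⟨h1, ⟨Or.inl ⟨by simp, by positivity⟩, h2⟩, by linarith⟩
        · push_cast [hh] at h2 h3
          exact ⟨h1, ⟨Or.inl ⟨by simp, by omega⟩, h2⟩, by linarith⟩
        · push_cast at h2 h3
          exact ⟨h1, ⟨Or.inr ⟨rfl, by omega, by omega⟩, by simpa using h2⟩, by linarith⟩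
      · rintro ⟨h1, ⟨(⟨rfl | rfl, h4⟩ | ⟨rfl, h4, h5⟩), h2⟩, h3⟩
        · have hh : 1 ≤ h := by omega
          refine Or.inr (Or.inl ⟨hh, rfl, h1, ?_, ?_⟩)
          · push_cast [hh]; exact h2
          · push_cast [hh]; linarith
        · refine Or.inl ⟨rfl, h1, ?_, ?_⟩
          · push_cast; exact h2
          · push_cast; linarith
        · refine Or.inr (Or.inr ⟨by omega, rfl, h1, ?_, ?_⟩)
          · simpa using h2
          · push_cast; linarith

lemma dyckCat_iff (n : ℕ) (l : List ℤ) : DyckCat n l ↔ l ∈ catPaths n 0 := by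
  simp [mem_catPaths, DyckCat]

/-- The generating polynomial of the cumulative size of catastrophes over the paths of length `n`
from altitude `h` to altitude `0`. -/
noncomputable def catPoly (u : ℂ) (n h : ℕ) : ℂ :=
  ∑ l ∈ catPaths n h, u ^ catSizeSum dyckJ h l

lemma catPoly_zero (u : ℂ) (h : ℕ) : catPoly u 0 h = if h = 0 then 1 else 0 := by
  by_cases hh : h = 0 <;> simp [catPoly, catPaths, hh, catSizeSum]

lemma catPoly_succ {u : ℂ} (hu : u ≠ 0) (n h : ℕ) :
    catPoly u (n + 1) h = catPoly u n (h + 1) + (if 1 ≤ h then catPoly u n (h - 1) else 0) +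
      (if 2 ≤ h then u ^ h * catPoly u n 0 else 0) := by
  have hinj : ∀ a : ℤ, Set.InjOn (List.cons a) (Set.univ : Set (List ℤ)) :=
    fun a x _ y _ hxy => (List.cons.inj hxy).2
  have hdis : ∀ (a b : ℤ) (A B : Finset (List ℤ)), a ≠ b →
      Disjoint (A.image (List.cons a)) (B.image (List.cons b)) := by
    intro a b A B hab
    rw [Finset.disjoint_left]
    rintro l h1 h2
    obtain ⟨x, -, rfl⟩ := Finset.mem_image.1 h1
    obtain ⟨y, -, hy⟩ := Finset.mem_image.1 h2
    exact hab (List.cons.inj hy).1.symm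
  unfold catPoly
  rw [catPaths, Finset.sum_union, Finset.sum_union, ← add_assoc]
  · congr 1
    · congr 1
      · rw [Finset.sum_image ((hinj 1).mono (Set.subset_univ _))]
        refine Finset.sum_congr rfl fun l _ => ?_
        have : ¬ ((1 : ℤ) = -(h : ℤ) ∧ 0 < (h : ℤ) ∧ -(h : ℤ) ∉ dyckJ) := by omega
        rw [catSizeSum, if_neg this]; simp
      · split_ifs with hh
        · rw [Finset.sum_image ((hinj _).mono (Set.subset_univ _))]
          refine Finset.sum_congr rfl fun l _ => ?_
          have : ¬ ((-1 : ℤ) = -(h : ℤ) ∧ 0 < (h : ℤ) ∧ -(h : ℤ) ∉ dyckJ) := by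
            rw [mem_dyckJ]; omega
          rw [catSizeSum, if_neg this]; push_cast [hh]; simp [sub_eq_add_neg]
        · simp
    · split_ifs with hh
      · rw [Finset.sum_image ((hinj _).mono (Set.subset_univ _)), Finset.mul_sum]
        refine Finset.sum_congr rfl fun l _ => ?_
        have : ((-(h : ℤ)) = -(h : ℤ) ∧ 0 < (h : ℤ) ∧ -(h : ℤ) ∉ dyckJ) := by
          rw [mem_dyckJ]; omega
        rw [catSizeSum, if_pos this, zpow_add₀ hu]; simp
      · simp
  · split_ifs
    · exact hdis _ _ _ _ (by omega)
    all_goals simp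
  · rw [Finset.disjoint_union_right]
    constructor
    · split_ifs
      · exact hdis _ _ _ _ (by omega)
      · simp
    · split_ifs
      · exact hdis _ _ _ _ (by omega)
      · simp

section Kernel

open PowerSeries

/-- The denominator `1 - u w - u² w³` of the generating function, where `z = w / (1 + w²)`. -/
noncomputable def catDenom (u : ℂ) : PowerSeries ℂ := 1 - C u * X - C u ^ 2 * X ^ 3

lemma catDenom_mul_inv (u : ℂ) : catDenom u * (catDenom u)⁻¹ = 1 :=
  PowerSeries.mul_inv_cancel _ (by simp [catDenom])

/-- The generating function of paths from altitude `h` to `0`, divided by `1 + w²`, in the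
variable `w` with `z = w / (1 + w²)`. -/
noncomputable def catSeries (u : ℂ) (h : ℕ) : PowerSeries ℂ :=
  if h = 0 then (1 - C u * X) * (catDenom u)⁻¹
  else C u ^ h * (X * (catDenom u)⁻¹ * (1 - C u⁻¹ * X)⁻¹) +
    ((1 - C u) * ((1 - C u * X) * (catDenom u)⁻¹) -
      X * (catDenom u)⁻¹ * (1 - C u⁻¹ * X)⁻¹) * X ^ h

lemma catSeries_rec {u : ℂ} (hu : u ≠ 0) (h : ℕ) :
    (1 + X ^ 2) * catSeries u h = (if h = 0 then 1 else 0) +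
      X * (catSeries u (h + 1) + (if 1 ≤ h then catSeries u (h - 1) else 0) +
        (if 2 ≤ h then C u ^ h * catSeries u 0 else 0)) := by
  have hD := catDenom_mul_inv u
  have hE : (1 - C u⁻¹ * X) * (1 - C u⁻¹ * X : PowerSeries ℂ)⁻¹ = 1 :=
    PowerSeries.mul_inv_cancel _ (by simp)
  have hV : (C u : PowerSeries ℂ) * C u⁻¹ = 1 := by
    rw [← map_mul, mul_inv_cancel₀ hu, map_one]
  rw [catDenom] at hD
  unfold catSeries catDenom
  set D : PowerSeries ℂ := (1 - C u * X - C u ^ 2 * X ^ 3)⁻¹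
  set E : PowerSeries ℂ := (1 - C u⁻¹ * X)⁻¹
  set U : PowerSeries ℂ := C u
  set V : PowerSeries ℂ := C u⁻¹
  have hB : (U - X) * (X * D * E) = U * X * D := by
    linear_combination (U * X * D) * hE + X ^ 2 * D * E * hV
  rcases h with _ | _ | m
  · simp
    linear_combination hD - X * hB
  · simp
    linear_combination (1 - U * X) * hB
  · simp
    linear_combination U ^ (m + 1) * (1 - U * X) * hB

lemma coeff_one_add_sq_pow_mul (n : ℕ) :
    coeff (n + 1) ((1 + X ^ 2 : PowerSeries ℂ) ^ n * (1 - X ^ 2)) = 0 := by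
  have h : (X : PowerSeries ℂ) * derivative ℂ ((1 + X ^ 2 : PowerSeries ℂ) ^ (n + 1)) -
      C ((n : ℂ) + 1) * (1 + X ^ 2) ^ (n + 1) =
      - (C ((n : ℂ) + 1) * ((1 + X ^ 2 : PowerSeries ℂ) ^ n * (1 - X ^ 2))) := by
    rw [Derivation.leibniz_pow]
    simp [Derivation.leibniz_pow]
    ring
  have h2 := congrArg (coeff (n + 1)) h
  rw [map_sub, map_neg, coeff_succ_X_mul, coeff_C_mul, coeff_C_mul, coeff_derivative] at h2
  have h3 : ((n : ℂ) + 1) * coeff (n + 1) ((1 + X ^ 2 : PowerSeries ℂ) ^ n * (1 - X ^ 2)) = 0 := by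
    linear_combination h2
  exact (mul_eq_zero.1 h3).resolve_left (by exact_mod_cast Nat.succ_ne_zero n)

lemma catPoly_eq_coeff {u : ℂ} (hu : u ≠ 0) (n h : ℕ) :
    catPoly u n h = coeff n ((1 + X ^ 2) ^ n * (1 - X ^ 2) * catSeries u h) := by
  induction n generalizing h with
  | zero =>
    rw [catPoly_zero]
    by_cases hh : h = 0
    · simp [hh, catSeries, catDenom]
    · simp [hh, catSeries]
  | succ n ih =>
    have e : (1 + X ^ 2) ^ (n + 1) * (1 - X ^ 2) * catSeries u h =
        (if h = 0 then (1 + X ^ 2 : PowerSeries ℂ) ^ n * (1 - X ^ 2) else 0) +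
        X * ((1 + X ^ 2) ^ n * (1 - X ^ 2) * catSeries u (h + 1) +
          (if 1 ≤ h then (1 + X ^ 2) ^ n * (1 - X ^ 2) * catSeries u (h - 1) else 0) +
          (if 2 ≤ h then C (u ^ h) * ((1 + X ^ 2) ^ n * (1 - X ^ 2) * catSeries u 0) else 0)) := by
      have := catSeries_rec hu h
      rw [map_pow]
      split_ifs at this ⊢ <;>
        linear_combination (1 + X ^ 2 : PowerSeries ℂ) ^ n * (1 - X ^ 2) * this
    rw [e, catPoly_succ hu, map_add, coeff_succ_X_mul, map_add, map_add, ih, ih, ih]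
    have z : coeff (n + 1) (if h = 0 then (1 + X ^ 2 : PowerSeries ℂ) ^ n * (1 - X ^ 2) else 0)
        = 0 := by
      split_ifs
      · exact coeff_one_add_sq_pow_mul n
      · simp
    rw [z, zero_add]
    congr 1
    · congr 1
      split_ifs <;> simp
    · split_ifs
      · rw [coeff_C_mul]
      · simp

lemma coeff_one_add_sq_pow_mul_eq_sum (n : ℕ) (g : PowerSeries ℂ) :
    coeff n ((1 + X ^ 2) ^ n * g) =
      ∑ j ∈ Finset.range (n + 1), (n.choose j : ℂ) *
        if 2 * j ≤ n then coeff (n - 2 * j) g else 0 := by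
  rw [add_comm, add_pow, Finset.sum_mul, map_sum]
  refine Finset.sum_congr rfl fun j _ => ?_
  rw [one_pow, mul_one, ← pow_mul, mul_comm (X ^ (2 * j)), mul_assoc, ← map_natCast (C (R := ℂ)),
    coeff_C_mul, coeff_X_pow_mul']

lemma add_inv_pow_eq_sum {𝕜 : Type*} [Field 𝕜] {r : 𝕜} (hr : r ≠ 0) (n : ℕ) :
    (r + r⁻¹) ^ n = ∑ j ∈ Finset.range (n + 1), (n.choose j : 𝕜) * (r ^ n * (r⁻¹ ^ 2) ^ j) := by
  have : r + r⁻¹ = r * (r⁻¹ ^ 2 + 1) := by field_simp; ring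
  rw [this, mul_pow, add_pow, Finset.mul_sum]
  refine Finset.sum_congr rfl fun j _ => ?_
  ring

lemma pow_sub_two_mul {𝕜 : Type*} [Field 𝕜] {r : 𝕜} (hr : r ≠ 0) {n j : ℕ} (h : 2 * j ≤ n) :
    r ^ (n - 2 * j) = r ^ n * (r⁻¹ ^ 2) ^ j := by
  rw [pow_sub₀ _ hr h, ← pow_mul, inv_pow]

lemma norm_coeff_one_add_sq_pow_mul_le {g : PowerSeries ℂ} {M r : ℝ} (hr : 0 < r)
    (hg : ∀ k, ‖coeff k g‖ ≤ M * r ^ k) (n : ℕ) :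
    ‖coeff n ((1 + X ^ 2) ^ n * g)‖ ≤ M * (r + r⁻¹) ^ n := by
  have hM : 0 ≤ M := by simpa using (norm_nonneg _).trans (hg 0)
  rw [coeff_one_add_sq_pow_mul_eq_sum, add_inv_pow_eq_sum hr.ne', Finset.mul_sum]
  refine (norm_sum_le _ _).trans (Finset.sum_le_sum fun j _ => ?_)
  rw [norm_mul, Complex.norm_natCast, mul_left_comm]
  refine mul_le_mul_of_nonneg_left ?_ (by positivity)
  split_ifs with h
  · exact (hg _).trans (by rw [pow_sub_two_mul hr.ne' h])
  · simp; positivity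

lemma norm_coeff_geom_sub_le {a : ℂ} (ha : 1 ≤ ‖a‖) (n : ℕ) :
    ‖coeff n ((1 + X ^ 2) ^ n * PowerSeries.mk fun k => a ^ k) - (a + a⁻¹) ^ n‖ ≤ 2 ^ n := by
  have ha0 : a ≠ 0 := by rintro rfl; norm_num at ha
  rw [coeff_one_add_sq_pow_mul_eq_sum, add_inv_pow_eq_sum ha0, ← Finset.sum_sub_distrib]
  have h2 : (2 : ℝ) ^ n = ∑ j ∈ Finset.range (n + 1), (n.choose j : ℝ) := by
    rw [← Nat.cast_sum, Nat.sum_range_choose]; simp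
  rw [h2]
  refine (norm_sum_le _ _).trans (Finset.sum_le_sum fun j _ => ?_)
  rw [← mul_sub, norm_mul, Complex.norm_natCast]
  refine mul_le_of_le_one_right (by positivity) ?_
  split_ifs with h
  · rw [coeff_mk, pow_sub_two_mul ha0 h, sub_self, norm_zero]; exact zero_le_one
  · rw [zero_sub, norm_neg, norm_mul, ← pow_mul, inv_pow, norm_inv, norm_pow, norm_pow,
      ← div_eq_mul_inv]
    exact div_le_one_of_le₀ (pow_le_pow_right₀ ha (by omega)) (by positivity)

lemma norm_coeff_inv_quadratic_le {p q : ℂ} {r : ℝ} (hr : 0 < r)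
    (h : ‖p‖ * r + ‖q‖ ≤ r ^ 2) (k : ℕ) :
    ‖coeff k (1 + C p * X + C q * X ^ 2)⁻¹‖ ≤ r ^ k := by
  have hQ : (1 + C p * X + C q * X ^ 2) * (1 + C p * X + C q * X ^ 2 : PowerSeries ℂ)⁻¹ = 1 :=
    PowerSeries.mul_inv_cancel _ (by simp)
  set d : PowerSeries ℂ := (1 + C p * X + C q * X ^ 2)⁻¹
  have hd : d + C p * (X * d) + C q * (X ^ 2 * d) = 1 := by linear_combination hQ
  have h0 : coeff 0 d = 1 := by
    have := congrArg (coeff 0) hd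
    simpa [coeff_X_pow_mul'] using this
  have h1 : coeff 1 d = - p := by
    have := congrArg (coeff (0 + 1)) hd
    rw [map_add, map_add, coeff_C_mul, coeff_C_mul, coeff_succ_X_mul, coeff_X_pow_mul', h0] at this
    simp [coeff_one] at this
    linear_combination this
  have h2 : ∀ m, coeff (m + 2) d = - p * coeff (m + 1) d - q * coeff m d := by
    intro m
    have := congrArg (coeff (m + 1 + 1)) hd
    rw [map_add, map_add, coeff_C_mul, coeff_C_mul, coeff_succ_X_mul, coeff_X_pow_mul'] at this
    simp [coeff_one] at this
    linear_combination this
  have hp : ‖p‖ ≤ r := by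
    by_contra hc
    push Not at hc
    nlinarith [norm_nonneg q]
  induction k using Nat.strong_induction_on with
  | _ k ih =>
    rcases k with _ | _ | m
    · rw [h0]; simp
    · rw [zero_add, h1]; simpa using hp
    · rw [h2]
      calc ‖-p * coeff (m + 1) d - q * coeff m d‖
          ≤ ‖p‖ * r ^ (m + 1) + ‖q‖ * r ^ m := by
            refine (norm_sub_le _ _).trans ?_
            rw [norm_mul, norm_mul, norm_neg]
            gcongr
            · exact ih _ (by omega)
            · exact ih _ (by omega)
        _ = (‖p‖ * r + ‖q‖) * r ^ m := by ring
        _ ≤ r ^ 2 * r ^ m := by gcongr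
        _ = r ^ (m + 1 + 1) := by ring

lemma norm_coeff_quadratic_mul_le {a b c : ℂ} {g : PowerSeries ℂ} {r : ℝ} (hr : 1 ≤ r)
    (hg : ∀ k, ‖coeff k g‖ ≤ r ^ k) (k : ℕ) :
    ‖coeff k ((C a + C b * X + C c * X ^ 2) * g)‖ ≤ (‖a‖ + ‖b‖ + ‖c‖) * r ^ k := by
  have e : (C a + C b * X + C c * X ^ 2) * g =
      C a * g + C b * (X ^ 1 * g) + C c * (X ^ 2 * g) := by ring
  have hX : ∀ i, ‖coeff k (X ^ i * g)‖ ≤ r ^ k := by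
    intro i
    rw [coeff_X_pow_mul']
    split_ifs with h
    · exact (hg _).trans (pow_le_pow_right₀ hr (Nat.sub_le _ _))
    · simp; positivity
  rw [e, map_add, map_add, coeff_C_mul, coeff_C_mul, coeff_C_mul]
  refine (norm_add₃_le).trans ?_
  rw [norm_mul, norm_mul, norm_mul, add_mul, add_mul]
  gcongr
  · exact hg k
  · exact hX 1
  · exact hX 2

/-- The weight `u` as a function of the uniformizing parameter `v`. -/
noncomputable def catU (v : ℂ) : ℂ := v ^ 3 / (1 - v)

/-- The inverse of the dominant singularity in the variable `w`. -/
noncomputable def catLam (v : ℂ) : ℂ := v ^ 2 / (1 - v)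

/-- The amplitude of the dominant term. -/
noncomputable def catAmp (v : ℂ) : ℂ := (1 - (catLam v)⁻¹ ^ 2) * (1 - v) / (3 - 2 * v)

/-- The constant of the error term. -/
noncomputable def catErr (v : ℂ) : ℝ :=
  ‖catAmp v‖ + (‖1 - catAmp v‖ + ‖(1 - v + catAmp v * (catU v * v)) / catLam v‖ + ‖-v‖)

lemma catSeries_zero_eq {v : ℂ} (h0 : v ≠ 0) (h1 : 1 - v ≠ 0) (h2 : 3 - 2 * v ≠ 0) :
    (1 - X ^ 2) * catSeries (catU v) 0 = C (catAmp v) * (PowerSeries.mk fun k => catLam v ^ k) +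
      (C (1 - catAmp v) + C ((1 - v + catAmp v * (catU v * v)) / catLam v) * X + C (-v) * X ^ 2) *
        (1 + C (v ^ 2) * X + C (catU v * v) * X ^ 2)⁻¹ := by
  have hl : catLam v ≠ 0 := by simp [catLam, h0, h1]
  have hu : catU v = v * catLam v := by simp [catLam, catU]; ring
  have hlv : catLam v * (1 - v) = v ^ 2 := by simp [catLam]; field_simp
  have hamp : catAmp v * (3 - 2 * v) * catLam v ^ 2 = (catLam v ^ 2 - 1) * (1 - v) := by
    rw [catAmp, div_mul_cancel₀ _ h2]; field_simp
  have hD := catDenom_mul_inv (catU v)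
  have hQ : (1 + C (v ^ 2) * X + C (catU v * v) * X ^ 2) *
      (1 + C (v ^ 2) * X + C (catU v * v) * X ^ 2 : PowerSeries ℂ)⁻¹ = 1 :=
    PowerSeries.mul_inv_cancel _ (by simp)
  have hL : (1 - C (catLam v) * X) * (PowerSeries.mk fun k => catLam v ^ k) = 1 := by
    ext k
    rw [sub_mul, one_mul, map_sub, mul_assoc, coeff_C_mul]
    rcases k with _ | k
    · simp
    · rw [coeff_succ_X_mul]; simp [coeff_one, pow_succ']
  have hfac : catDenom (catU v) =
      (1 - C (catLam v) * X) * (1 + C (v ^ 2) * X + C (catU v * v) * X ^ 2) := by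
    have e1 : v ^ 2 = catLam v - catU v := by rw [hu]; linear_combination -hlv
    have e2 : catU v * v = catLam v * v ^ 2 := by rw [hu]; ring
    have e3 : catU v ^ 2 = catLam v * (catU v * v) := by rw [hu]; ring
    rw [catDenom, ← map_pow, e3, e2, map_mul, map_mul]
    have e4 : (C (v ^ 2) : PowerSeries ℂ) = C (catLam v) - C (catU v) := by rw [e1, map_sub]
    linear_combination (-X) * e4
  have hnum : (1 - X ^ 2) * (1 - C (catU v) * X) =
      C (catAmp v) * (1 + C (v ^ 2) * X + C (catU v * v) * X ^ 2) +
      (C (1 - catAmp v) + C ((1 - v + catAmp v * (catU v * v)) / catLam v) * X + C (-v) * X ^ 2) *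
        (1 - C (catLam v) * X) := by
    set A := catAmp v
    set B := (1 - v + A * (catU v * v)) / catLam v
    have f1 : -catU v = A * v ^ 2 + B - (1 - A) * catLam v := by
      rw [eq_comm, ← sub_eq_zero]
      apply (mul_eq_zero.1 ?_).resolve_right hl
      have : B * catLam v = 1 - v + A * (catU v * v) := by simp only [B]; field_simp
      linear_combination this + hamp - 2 * A * catLam v * hlv + (A * v + catLam v) * hu
    have f2 : (-1 : ℂ) = A * (catU v * v) - v - B * catLam v := by
      simp only [B]; field_simp; ring
    have g1 := congrArg (C (R := ℂ)) f1
    have g2 := congrArg (C (R := ℂ)) f2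
    have g3 := congrArg (C (R := ℂ)) hu
    simp only [map_sub, map_add, map_mul, map_neg, map_one] at g1 g2 g3 ⊢
    linear_combination X * g1 + X ^ 2 * g2 + X ^ 3 * g3
  set Q : PowerSeries ℂ := 1 + C (v ^ 2) * X + C (catU v * v) * X ^ 2
  set L : PowerSeries ℂ := PowerSeries.mk fun k => catLam v ^ k
  set R : PowerSeries ℂ :=
    C (1 - catAmp v) + C ((1 - v + catAmp v * (catU v * v)) / catLam v) * X + C (-v) * X ^ 2
  have hDi : (catDenom (catU v))⁻¹ = L * Q⁻¹ := by
    rw [PowerSeries.inv_eq_iff_mul_eq_one (by simp [catDenom]), hfac]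
    linear_combination (Q * Q⁻¹) * hL + hQ
  rw [catSeries, if_pos rfl, hDi]
  linear_combination (L * Q⁻¹) * hnum + (C (catAmp v) * L) * hQ + R * Q⁻¹ * hL

theorem norm_catPoly_sub_le {v : ℂ} (h0 : v ≠ 0) (h1 : 1 - v ≠ 0) (h2 : 3 - 2 * v ≠ 0)
    (hl : 1 ≤ ‖catLam v‖) (hq : ‖v ^ 2‖ * (6 / 5) + ‖catU v * v‖ ≤ (6 / 5) ^ 2) (n : ℕ) :
    ‖catPoly (catU v) n 0 - catAmp v * (catLam v + (catLam v)⁻¹) ^ n‖ ≤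
      catErr v * (61 / 30) ^ n := by
  have hu : catU v ≠ 0 := by simp [catU, h0, h1]
  rw [catPoly_eq_coeff hu, mul_assoc, catSeries_zero_eq h0 h1 h2, mul_add, map_add,
    mul_left_comm, coeff_C_mul, add_sub_right_comm, ← mul_sub, catErr, add_mul ‖catAmp v‖]
  refine (norm_add_le _ _).trans (add_le_add ?_ ?_)
  · rw [norm_mul]
    refine mul_le_mul_of_nonneg_left ((norm_coeff_geom_sub_le hl n).trans ?_) (norm_nonneg _)
    gcongr; norm_num
  · have := norm_coeff_one_add_sq_pow_mul_le (by norm_num : (0 : ℝ) < 6 / 5)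
      (norm_coeff_quadratic_mul_le (a := 1 - catAmp v)
        (b := (1 - v + catAmp v * (catU v * v)) / catLam v) (c := -v)
        (by norm_num : (1 : ℝ) ≤ 6 / 5) (norm_coeff_inv_quadratic_le (by norm_num) hq)) n
    norm_num at this ⊢
    exact this

end Kernel

section Root

lemma exists_catRoot : ∃ r : ℝ, 3 / 5 < r ∧ r < 7 / 10 ∧ r ^ 3 + r = 1 := by
  have hc : ContinuousOn (fun r : ℝ => r ^ 3 + r) (Set.Icc (3 / 5) (7 / 10)) := by fun_prop
  obtain ⟨r, hr, h⟩ := intermediate_value_Ioo (by norm_num : (3 / 5 : ℝ) ≤ 7 / 10) hc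
    (show (1 : ℝ) ∈ Set.Ioo _ _ by norm_num)
  exact ⟨r, hr.1, hr.2, h⟩

lemma mean_eq {μ r : ℝ} (hμ : 31 * μ ^ 3 + 62 * μ ^ 2 + 71 * μ - 27 = 0) (hr : r ^ 3 + r = 1) :
    μ = (-18 + 37 * r + 4 * r ^ 2) / 31 := by
  set m := (-18 + 37 * r + 4 * r ^ 2) / 31 with hm
  have h : 31 * m ^ 3 + 62 * m ^ 2 + 71 * m - 27 = 0 := by
    rw [hm]
    linear_combination (51309 / 961 + 532 / 31 * r + 1776 / 961 * r ^ 2 +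
      64 / 961 * r ^ 3) * hr
  have h2 : (μ - m) * (31 * (μ ^ 2 + μ * m + m ^ 2) + 62 * (μ + m) + 71) = 0 := by
    linear_combination hμ - h
  have h3 : 0 < 31 * (μ ^ 2 + μ * m + m ^ 2) + 62 * (μ + m) + 71 := by
    nlinarith [sq_nonneg (μ - m), sq_nonneg (μ + m + 4 / 3)]
  linarith [(mul_eq_zero.1 h2).resolve_right h3.ne']

lemma variance_eq {σ r : ℝ}
    (hσ : 29791 * σ ^ 6 - 59582 * σ ^ 4 + 298411 * σ ^ 2 - 159099 = 0) (hr : r ^ 3 + r = 1) :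
    σ ^ 2 = (-88 + 1693 * r - 1093 * r ^ 2) / 961 := by
  set m := (-88 + 1693 * r - 1093 * r ^ 2) / 961 with hm
  have h : 29791 * m ^ 3 - 59582 * m ^ 2 + 298411 * m - 159099 = 0 := by
    rw [hm]
    linear_combination (5569348957 / 29791 - 345296188 / 961 * r +
      6067622271 / 29791 * r ^ 2 - 1305751357 / 29791 * r ^ 3) * hr
  set y := σ ^ 2
  have h2 : (y - m) * (29791 * (y ^ 2 + y * m + m ^ 2) - 59582 * (y + m) + 298411) = 0 := by
    linear_combination hσ - h
  have h3 : 0 < 29791 * (y ^ 2 + y * m + m ^ 2) - 59582 * (y + m) + 298411 := by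
    nlinarith [sq_nonneg (y - m), sq_nonneg (y + m - 4 / 3)]
  linarith [(mul_eq_zero.1 h2).resolve_right h3.ne']

end Root

section Expansion

open Asymptotics

/-- Second-order expansion of a function given by its logarithmic derivative. -/
lemma isLittleO_of_logDeriv {f g : ℂ → ℂ} {a k : ℂ}
    (hf : ∀ᶠ v in 𝓝 a, HasDerivAt f (f v * g v) v) (hfa : f a = 1) (hga : g a = 0)
    (hg : HasDerivAt g k a) :
    (fun v => f v - 1 - k / 2 * (v - a) ^ 2) =o[𝓝 a] fun v => (v - a) ^ 2 := by
  have hfg : HasDerivAt (fun v => f v * g v) k a := by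
    have := hf.self_of_nhds.mul hg
    simp only [hfa, hga, mul_zero, zero_add, one_mul] at this
    exact this
  have ho := hasDerivAt_iff_isLittleO.1 hfg
  refine IsLittleO.of_bound fun ε hε => ?_
  have h1 := (ho.def hε).and hf
  obtain ⟨δ, hδ, hball⟩ := Metric.eventually_nhds_iff_ball.1 h1
  filter_upwards [Metric.ball_mem_nhds a hδ] with v hv
  have hsub : Metric.closedBall a ‖v - a‖ ⊆ Metric.ball a δ :=
    Metric.closedBall_subset_ball (by rwa [← dist_eq_norm])
  have key := Convex.norm_image_sub_le_of_norm_hasDerivWithin_le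
    (f := fun v => f v - 1 - k / 2 * (v - a) ^ 2) (f' := fun v => f v * g v - k * (v - a))
    (C := ε * ‖v - a‖) (s := Metric.closedBall a ‖v - a‖) (x := a) (y := v) ?_ ?_
    (convex_closedBall _ _) (Metric.mem_closedBall_self (norm_nonneg _))
    (by simp [dist_eq_norm])
  · simp only [hfa, sub_self] at key
    calc _ ≤ ε * ‖v - a‖ * ‖v - a‖ := by simpa using key
      _ = _ := by rw [norm_pow]; ring
  · intro w hw
    have h2 := (hball w (hsub hw)).2
    have h3 : HasDerivAt (fun v => k / 2 * (v - a) ^ 2) (k * (w - a)) w := by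
      have := (((hasDerivAt_id w).sub_const a).pow 2).const_mul (k / 2)
      convert! this using 1
      simp; ring
    exact ((h2.sub_const 1).sub h3).hasDerivWithinAt
  · intro w hw
    have h2 := (hball w (hsub hw)).1
    simp only [hfa, hga, mul_zero, sub_zero, smul_eq_mul] at h2
    rw [mul_comm (w - a)] at h2
    refine h2.trans ?_
    gcongr
    simpa [dist_eq_norm] using hw

/-- The exponential growth rate of the generating polynomials. -/
noncomputable def catGrowth (v : ℂ) : ℂ := catLam v + (catLam v)⁻¹

/-- The growth rate normalised by its value at `r` and by the mean `m`. -/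
noncomputable def catPsi (m r v : ℂ) : ℂ :=
  catGrowth v / catGrowth r * Complex.exp (-m * Complex.log (catU v))

/-- The logarithmic derivative of `catPsi`. -/
noncomputable def catLogDeriv (m v : ℂ) : ℂ :=
  ((2 - v) * ((v ^ 4 - (1 - v) ^ 2) / (v ^ 4 + (1 - v) ^ 2)) - m * (3 - 2 * v)) / (v * (1 - v))

lemma hasStrictDerivAt_catU {v : ℂ} (h0 : v ≠ 0) (h1 : 1 - v ≠ 0) :
    HasStrictDerivAt catU (catU v * ((3 - 2 * v) / (v * (1 - v)))) v := by
  have := ((hasStrictDerivAt_id v).pow 3).div ((hasStrictDerivAt_id v).const_sub 1) h1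
  convert! this using 1
  simp [catU]
  field_simp
  ring

lemma hasDerivAt_catLam {v : ℂ} (h0 : v ≠ 0) (h1 : 1 - v ≠ 0) :
    HasDerivAt catLam (catLam v * ((2 - v) / (v * (1 - v)))) v := by
  have := ((hasDerivAt_id v).pow 2).div ((hasDerivAt_id v).const_sub 1) h1
  convert! this using 1
  simp [catLam]
  field_simp
  ring

lemma hasDerivAt_catPsi {m r v : ℂ} (h0 : v ≠ 0) (h1 : 1 - v ≠ 0)
    (h2 : v ^ 4 + (1 - v) ^ 2 ≠ 0) (h3 : catU v ∈ Complex.slitPlane) :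
    HasDerivAt (catPsi m r) (catPsi m r v * catLogDeriv m v) v := by
  have hl : catLam v ≠ 0 := by simp [catLam, h0, h1]
  have hu : catU v ≠ 0 := by simp [catU, h0, h1]
  have dl := hasDerivAt_catLam h0 h1
  have dg : HasDerivAt catGrowth (catGrowth v *
      ((2 - v) * ((v ^ 4 - (1 - v) ^ 2) / (v ^ 4 + (1 - v) ^ 2)) / (v * (1 - v)))) v := by
    convert! dl.add (dl.inv hl) using 1
    simp only [catGrowth, catLam]
    field_simp
    ring
  have du := ((((hasStrictDerivAt_catU h0 h1).hasDerivAt.clog h3).const_mul (-m))).cexp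
  convert! (dg.div_const (catGrowth r)).mul du using 1
  simp only [catPsi, catLogDeriv]
  field_simp
  ring

end Expansion

section Asymptotics

open Asymptotics

variable {r : ℝ}

lemma root_ofReal (hr : r ^ 3 + r = 1) : (r : ℂ) ^ 3 + r = 1 := by exact_mod_cast hr

lemma root_ne_zero (h1 : 3 / 5 < r) : (r : ℂ) ≠ 0 := by
  exact_mod_cast (by linarith : (0 : ℝ) < r).ne'

lemma one_sub_root_ne_zero (h2 : r < 7 / 10) : 1 - (r : ℂ) ≠ 0 := by
  exact_mod_cast (by linarith : (0 : ℝ) < 1 - r).ne'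

lemma three_sub_root_ne_zero (h2 : r < 7 / 10) : 3 - 2 * (r : ℂ) ≠ 0 := by
  exact_mod_cast (by linarith : (0 : ℝ) < 3 - 2 * r).ne'

lemma quartic_root_ne_zero (h2 : r < 7 / 10) : (r : ℂ) ^ 4 + (1 - (r : ℂ)) ^ 2 ≠ 0 := by
  have : 0 < r ^ 4 + (1 - r) ^ 2 := by
    have : 0 < 1 - r := by linarith
    positivity
  exact_mod_cast this.ne'

lemma catU_root (h2 : r < 7 / 10) (hr : r ^ 3 + r = 1) : catU r = 1 := by
  rw [catU, div_eq_one_iff_eq (one_sub_root_ne_zero h2)]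
  linear_combination root_ofReal hr

lemma catLam_root (h1 : 3 / 5 < r) (h2 : r < 7 / 10) (hr : r ^ 3 + r = 1) :
    catLam r = (r : ℂ)⁻¹ := by
  have := root_ne_zero h1
  rw [catLam, div_eq_iff (one_sub_root_ne_zero h2)]
  field_simp
  linear_combination root_ofReal hr

lemma catGrowth_root (h1 : 3 / 5 < r) (h2 : r < 7 / 10) (hr : r ^ 3 + r = 1) :
    catGrowth r = ((r + r⁻¹ : ℝ) : ℂ) := by
  rw [catGrowth, catLam_root h1 h2 hr, inv_inv]
  push_cast
  ring

lemma lt_norm_catGrowth_root (h1 : 3 / 5 < r) (h2 : r < 7 / 10) (hr : r ^ 3 + r = 1) :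
    61 / 30 < ‖catGrowth r‖ := by
  have hr0 : 0 < r := by linarith
  rw [catGrowth_root h1 h2 hr, Complex.norm_real, Real.norm_of_nonneg (by positivity)]
  have : r + r⁻¹ = (r ^ 2 + 1) / r := by field_simp
  rw [this, lt_div_iff₀ hr0]
  nlinarith

lemma catAmp_root_ne_zero (h1 : 3 / 5 < r) (h2 : r < 7 / 10) (hr : r ^ 3 + r = 1) :
    catAmp r ≠ 0 := by
  rw [catAmp, catLam_root h1 h2 hr, inv_inv]
  refine div_ne_zero (mul_ne_zero ?_ (one_sub_root_ne_zero h2)) (three_sub_root_ne_zero h2)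
  have : (0 : ℝ) < 1 - r ^ 2 := by nlinarith
  exact_mod_cast this.ne'

lemma continuousAt_catU {v : ℂ} (h : 1 - v ≠ 0) : ContinuousAt catU v := by
  unfold catU; fun_prop (disch := assumption)

lemma continuousAt_catLam {v : ℂ} (h : 1 - v ≠ 0) : ContinuousAt catLam v := by
  unfold catLam; fun_prop (disch := assumption)

lemma continuousAt_catAmp {v : ℂ} (h0 : v ≠ 0) (h1 : 1 - v ≠ 0) (h2 : 3 - 2 * v ≠ 0) :
    ContinuousAt catAmp v := by
  have hl : catLam v ≠ 0 := by simp [catLam, h0, h1]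
  have := continuousAt_catLam h1
  unfold catAmp
  fun_prop (disch := assumption)

lemma continuousAt_catErr {v : ℂ} (h0 : v ≠ 0) (h1 : 1 - v ≠ 0) (h2 : 3 - 2 * v ≠ 0) :
    ContinuousAt catErr v := by
  have hl : catLam v ≠ 0 := by simp [catLam, h0, h1]
  have := continuousAt_catLam h1
  have := continuousAt_catU h1
  have := continuousAt_catAmp h0 h1 h2
  unfold catErr
  fun_prop (disch := assumption)

lemma eventually_norm_catPoly_sub_le (h1 : 3 / 5 < r) (h2 : r < 7 / 10) (hr : r ^ 3 + r = 1) :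
    ∀ᶠ v in 𝓝 (r : ℂ), ∀ n, ‖catPoly (catU v) n 0 - catAmp v * catGrowth v ^ n‖ ≤
      catErr v * (61 / 30) ^ n := by
  have hr0 : 0 < r := by linarith
  have a0 := root_ne_zero h1
  have a1 := one_sub_root_ne_zero h2
  have a2 := three_sub_root_ne_zero h2
  have cU := continuousAt_catU a1
  have cL := continuousAt_catLam a1
  have e0 : ∀ᶠ v in 𝓝 (r : ℂ), v ≠ 0 := eventually_ne_nhds a0
  have e1 : ∀ᶠ v in 𝓝 (r : ℂ), 1 - v ≠ 0 :=
    (show ContinuousAt (fun v : ℂ => 1 - v) r by fun_prop).eventually_ne a1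
  have e2 : ∀ᶠ v in 𝓝 (r : ℂ), 3 - 2 * v ≠ 0 :=
    (show ContinuousAt (fun v : ℂ => 3 - 2 * v) r by fun_prop).eventually_ne a2
  have e3 : ∀ᶠ v in 𝓝 (r : ℂ), 1 < ‖catLam v‖ := by
    refine cL.norm.eventually_const_lt ?_
    change 1 < ‖catLam r‖
    rw [catLam_root h1 h2 hr, norm_inv, Complex.norm_real, Real.norm_of_nonneg hr0.le]
    exact (one_lt_inv₀ hr0).2 (by linarith)
  have e4 : ∀ᶠ v in 𝓝 (r : ℂ), ‖v ^ 2‖ * (6 / 5) + ‖catU v * v‖ < (6 / 5) ^ 2 := by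
    have hc : ContinuousAt (fun v : ℂ => ‖v ^ 2‖ * (6 / 5) + ‖catU v * v‖) r := by fun_prop
    refine hc.tendsto.eventually_lt_const ?_
    · rw [catU_root h2 hr, one_mul, norm_pow, Complex.norm_real, Real.norm_of_nonneg hr0.le]
      nlinarith
  filter_upwards [e0, e1, e2, e3, e4] with v b0 b1 b2 b3 b4 n
  exact norm_catPoly_sub_le b0 b1 b2 b3.le b4.le n

lemma catLogDeriv_root (h2 : r < 7 / 10) (hr : r ^ 3 + r = 1) :
    catLogDeriv ((-18 + 37 * r + 4 * r ^ 2) / 31) r = 0 := by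
  have ha := root_ofReal hr
  have hD := quartic_root_ne_zero h2
  have hH : ((r : ℂ) ^ 4 - (1 - r) ^ 2) / ((r : ℂ) ^ 4 + (1 - r) ^ 2) = 2 * r - 1 := by
    rw [div_eq_iff hD]
    linear_combination ((2) * (r : ℂ) ^ 1 + (-2) * (r : ℂ) ^ 2) * ha
  rw [catLogDeriv, hH]
  refine div_eq_zero_iff.2 (Or.inl ?_)
  linear_combination ((8/31) * (r : ℂ) ^ 0) * ha

lemma hasDerivAt_catLogDeriv (h1 : 3 / 5 < r) (h2 : r < 7 / 10) (hr : r ^ 3 + r = 1) :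
    HasDerivAt (catLogDeriv ((-18 + 37 * r + 4 * r ^ 2) / 31))
      ((491 - 484 * r + 132 * r ^ 2) / 31 / (r * (1 - r))) (r : ℂ) := by
  have ha := root_ofReal hr
  have hD := quartic_root_ne_zero h2
  have a0 := root_ne_zero h1
  have a1 := one_sub_root_ne_zero h2
  have hz := catLogDeriv_root h2 hr
  have hH : ((r : ℂ) ^ 4 - (1 - r) ^ 2) / ((r : ℂ) ^ 4 + (1 - r) ^ 2) = 2 * r - 1 := by
    rw [div_eq_iff hD]
    linear_combination ((2) * (r : ℂ) ^ 1 + (-2) * (r : ℂ) ^ 2) * ha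
  have d4 := (hasDerivAt_id (r : ℂ)).pow 4
  have ds := ((hasDerivAt_id (r : ℂ)).const_sub 1).pow 2
  have dH : HasDerivAt (fun v : ℂ => (v ^ 4 - (1 - v) ^ 2) / (v ^ 4 + (1 - v) ^ 2)) 
      (8 - 4 * (r : ℂ)) (r : ℂ) := by
    convert! (d4.sub ds).div (d4.add ds) hD using 1
    simp
    rw [eq_div_iff (pow_ne_zero 2 hD)]
    linear_combination (-8 + 28 * (r : ℂ) - 36 * (r : ℂ) ^ 2 + 20 * (r : ℂ) ^ 3 -
      4 * (r : ℂ) ^ 4 + 8 * (r : ℂ) ^ 5 - 4 * (r : ℂ) ^ 6) * ha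
  have dG := ((((hasDerivAt_id (r : ℂ)).const_sub 2).mul dH).sub
    ((((hasDerivAt_id (r : ℂ)).const_mul 2).const_sub 3).const_mul
      ((-18 + 37 * (r : ℂ) + 4 * r ^ 2) / 31))).div
    ((hasDerivAt_id (r : ℂ)).mul ((hasDerivAt_id (r : ℂ)).const_sub 1)) (mul_ne_zero a0 a1)
  convert! dG using 1
  have hz' := (div_eq_zero_iff.1 hz).resolve_right (mul_ne_zero a0 a1)
  simp [hH] at hz' ⊢
  rw [hz']
  field_simp
  ring

lemma exists_catU_inverse (h1 : 3 / 5 < r) (h2 : r < 7 / 10) (hr : r ^ 3 + r = 1) :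
    ∃ V : ℂ → ℂ, V 0 = r ∧ HasDerivAt V (r * (1 - r) / (3 - 2 * r)) 0 ∧
      ∀ᶠ s in 𝓝 0, catU (V s) = Complex.exp s := by
  have a0 := root_ne_zero h1
  have a1 := one_sub_root_ne_zero h2
  have a2 := three_sub_root_ne_zero h2
  have hU := catU_root h2 hr
  have hd := hasStrictDerivAt_catU a0 a1
  have hne : catU r * ((3 - 2 * r) / (r * (1 - r))) ≠ 0 := by
    rw [hU, one_mul]
    exact div_ne_zero a2 (mul_ne_zero a0 a1)
  have hinv := (hd.to_localInverse hne).hasDerivAt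
  have hright := hd.eventually_right_inverse hne
  set g := hd.localInverse catU _ _ hne
  have hg : g (catU r) = r :=
    HasStrictFDerivAt.localInverse_apply_image (hd.hasStrictFDerivAt_equiv hne)
  rw [hU] at hinv hright hg
  refine ⟨fun s => g (Complex.exp s), by simpa using hg, ?_, ?_⟩
  · have he := Complex.hasDerivAt_exp 0
    rw [Complex.exp_zero] at he
    have := HasDerivAt.comp (h₂ := g) (0 : ℂ) (by rwa [Complex.exp_zero]) he
    convert! this using 1
    rw [one_mul, mul_one, inv_div]
  · have : Tendsto Complex.exp (𝓝 0) (𝓝 1) := by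
      simpa using Complex.continuous_exp.tendsto 0
    exact this.eventually hright

lemma tendsto_div_sqrt_mul_I (b : ℝ) :
    Tendsto (fun n : ℕ => ((b / √n : ℝ) : ℂ) * Complex.I) atTop (𝓝 0) := by
  have h : Tendsto (fun n : ℕ => b / √n) atTop (𝓝 0) :=
    (Real.tendsto_sqrt_atTop.comp tendsto_natCast_atTop_atTop).const_div_atTop b
  have := ((Complex.continuous_ofReal.tendsto 0).comp h).mul_const Complex.I
  simpa using this

lemma tendsto_catPoly (h1 : 3 / 5 < r) (h2 : r < 7 / 10) (hr : r ^ 3 + r = 1) {m : ℝ}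
    (hm : m = (-18 + 37 * r + 4 * r ^ 2) / 31) (b : ℝ) :
    Tendsto (fun n : ℕ => Complex.exp (-m * (n * (((b / √n : ℝ) : ℂ) * Complex.I))) *
        catPoly (Complex.exp (((b / √n : ℝ) : ℂ) * Complex.I)) n 0 / catGrowth r ^ n) atTop
      (𝓝 (catAmp r * Complex.exp (((-88 + 1693 * r - 1093 * r ^ 2) / 961 : ℝ) * -b ^ 2 / 2))) := by
  have a0 := root_ne_zero h1
  have a1 := one_sub_root_ne_zero h2
  have a2 := three_sub_root_ne_zero h2
  have hU := catU_root h2 hr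
  have hgrow := lt_norm_catGrowth_root h1 h2 hr
  have hg0 : catGrowth r ≠ 0 := norm_pos_iff.1 (by linarith)
  have hmc : (m : ℂ) = (-18 + 37 * r + 4 * r ^ 2) / 31 := by rw [hm]; push_cast; ring
  obtain ⟨V, hV0, hVd, hVe⟩ := exists_catU_inverse h1 h2 hr
  set T : ℂ := r * (1 - r) / (3 - 2 * r) with hT
  set k : ℂ := (491 - 484 * r + 132 * r ^ 2) / 31 / (r * (1 - r)) with hk
  set s : ℕ → ℂ := fun n => ((b / √n : ℝ) : ℂ) * Complex.I with hs
  have hs0 : Tendsto s atTop (𝓝 0) := tendsto_div_sqrt_mul_I b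
  have hVt : Tendsto (fun n => V (s n)) atTop (𝓝 (r : ℂ)) := by
    rw [← hV0]; exact hVd.continuousAt.tendsto.comp hs0
  have hsq : ∀ᶠ n : ℕ in atTop, (√n : ℂ) * s n = b * Complex.I := by
    filter_upwards [eventually_gt_atTop 0] with n hn
    have : (√n : ℂ) ≠ 0 := by
      exact_mod_cast (Real.sqrt_pos.2 (by exact_mod_cast hn)).ne'
    simp only [hs]
    push_cast
    field_simp
  have hlin : Tendsto (fun n : ℕ => (√n : ℂ) * (V (s n) - r)) atTop (𝓝 (T * (b * Complex.I))) := by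
    have ho : (fun n => V (s n) - r - s n * T) =o[atTop] s := by
      have := (hasDerivAt_iff_isLittleO.1 hVd).comp_tendsto hs0
      simpa [Function.comp_def, hV0] using this
    have ho2 : Tendsto (fun n : ℕ => (√n : ℂ) * (V (s n) - r - s n * T)) atTop (𝓝 0) := by
      have h3 : (fun n : ℕ => (√n : ℂ) * (V (s n) - r - s n * T)) =o[atTop]
          fun n : ℕ => (√n : ℂ) * s n := (isBigO_refl _ _).mul_isLittleO ho
      refine ((h3.trans_eventuallyEq hsq).trans_isBigO ?_ : _ =o[atTop] fun _ : ℕ => (1 : ℂ)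
        ).tendsto_zero_of_tendsto tendsto_const_nhds
      exact isBigO_const_const _ one_ne_zero _
    have h4 := ho2.add_const (T * (b * Complex.I))
    rw [zero_add] at h4
    refine h4.congr' ?_
    filter_upwards [hsq] with n hn
    rw [← hn]; ring
  have hsqr : Tendsto (fun n : ℕ => (n : ℂ) * (V (s n) - r) ^ 2) atTop
      (𝓝 ((T * (b * Complex.I)) ^ 2)) := by
    refine (hlin.pow 2).congr fun n => ?_
    rw [mul_pow]
    congr 1
    exact_mod_cast Real.sq_sqrt (Nat.cast_nonneg n)
  have hPsi : ∀ᶠ v in 𝓝 (r : ℂ), HasDerivAt (catPsi m r) (catPsi m r v * catLogDeriv m v) v := by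
    have e0 : ∀ᶠ v in 𝓝 (r : ℂ), v ≠ 0 := eventually_ne_nhds a0
    have e1 : ∀ᶠ v in 𝓝 (r : ℂ), 1 - v ≠ 0 :=
      (show ContinuousAt (fun v : ℂ => 1 - v) r by fun_prop).eventually_ne a1
    have e2 : ∀ᶠ v in 𝓝 (r : ℂ), v ^ 4 + (1 - v) ^ 2 ≠ 0 :=
      (show ContinuousAt (fun v : ℂ => v ^ 4 + (1 - v) ^ 2) r by fun_prop).eventually_ne
        (quartic_root_ne_zero h2)
    have e3 : ∀ᶠ v in 𝓝 (r : ℂ), catU v ∈ Complex.slitPlane :=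
      (continuousAt_catU a1).eventually_mem
        (Complex.isOpen_slitPlane.mem_nhds (by rw [hU]; exact Complex.one_mem_slitPlane))
    filter_upwards [e0, e1, e2, e3] with v b0 b1 b2 b3
    exact hasDerivAt_catPsi b0 b1 b2 b3
  have hPsi1 : catPsi m r r = 1 := by
    simp [catPsi, hU, hg0]
  have hexp : Tendsto (fun n : ℕ => (n : ℂ) * (catPsi m r (V (s n)) - 1)) atTop
      (𝓝 (k / 2 * (T * (b * Complex.I)) ^ 2)) := by
    have hl : catLogDeriv m r = 0 := by rw [hmc]; exact catLogDeriv_root h2 hr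
    have hld : HasDerivAt (catLogDeriv m) k r := by
      rw [hmc]; exact hasDerivAt_catLogDeriv h1 h2 hr
    have ho := (isLittleO_of_logDeriv hPsi hPsi1 hl hld).comp_tendsto hVt
    have ho2 : Tendsto (fun n : ℕ => (n : ℂ) *
        (catPsi m r (V (s n)) - 1 - k / 2 * (V (s n) - r) ^ 2)) atTop (𝓝 0) := by
      have h3 := (isBigO_refl (fun n : ℕ => (n : ℂ)) atTop).mul_isLittleO ho
      exact (h3.trans_isBigO (hsqr.isBigO_one ℂ)).tendsto_zero_of_tendsto tendsto_const_nhds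
    have h4 := ho2.add (hsqr.const_mul (k / 2))
    rw [zero_add] at h4
    exact h4.congr fun n => by ring
  have hpow : Tendsto (fun n : ℕ => catPsi m r (V (s n)) ^ n) atTop
      (𝓝 (Complex.exp (k / 2 * (T * (b * Complex.I)) ^ 2))) := by
    refine (Complex.tendsto_one_add_pow_exp_of_tendsto hexp).congr fun n => ?_
    rw [add_sub_cancel]
  have hvar : k / 2 * (T * (b * Complex.I)) ^ 2 =
      ((-88 + 1693 * r - 1093 * r ^ 2) / 961 : ℝ) * -b ^ 2 / 2 := by
    have hkT : k * T ^ 2 = ((-88 + 1693 * r - 1093 * r ^ 2) / 961 : ℝ) := by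
      have ha := root_ofReal hr
      have : k * T ^ 2 = (491 - 484 * r + 132 * r ^ 2) / 31 * (r * (1 - r)) / (3 - 2 * r) ^ 2 := by
        rw [hk, hT]; field_simp
      rw [this, div_eq_iff (pow_ne_zero 2 a2)]
      push_cast
      linear_combination ((-792/961) * (r : ℂ) ^ 0 + (280/961) * (r : ℂ) ^ 1) * ha
    rw [← hkT]
    linear_combination (k * T ^ 2 * b ^ 2 / 2) * Complex.I_sq
  have hamp : Tendsto (fun n => catAmp (V (s n))) atTop (𝓝 (catAmp r)) :=
    (continuousAt_catAmp a0 a1 a2).tendsto.comp hVt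
  have herr : Tendsto (fun n : ℕ => catErr (V (s n)) * ((61 / 30) / ‖catGrowth r‖) ^ n) atTop
      (𝓝 0) := by
    have h3 := tendsto_pow_atTop_nhds_zero_of_lt_one
      (r := (61 / 30) / ‖catGrowth r‖) (by positivity) ((div_lt_one (by linarith)).2 hgrow)
    simpa using ((continuousAt_catErr a0 a1 a2).tendsto.comp hVt).mul h3
  have hmain : Tendsto (fun n => catAmp (V (s n)) * catPsi m r (V (s n)) ^ n) atTop
      (𝓝 (catAmp r * Complex.exp (((-88 + 1693 * r - 1093 * r ^ 2) / 961 : ℝ) * -b ^ 2 / 2))) := by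
    rw [← hvar]; exact hamp.mul hpow
  have hdiff : Tendsto (fun n : ℕ => Complex.exp (-m * (n * s n)) *
        catPoly (Complex.exp (s n)) n 0 / catGrowth r ^ n -
        catAmp (V (s n)) * catPsi m r (V (s n)) ^ n) atTop (𝓝 0) := by
    refine squeeze_zero_norm' ?_ herr
    have him : ∀ᶠ z : ℂ in 𝓝 0, -Real.pi < z.im ∧ z.im < Real.pi := by
      refine (Complex.continuous_im.tendsto 0).eventually (Ioo_mem_nhds ?_ ?_) <;>
        simp [Real.pi_pos]
    filter_upwards [hVt.eventually (eventually_norm_catPoly_sub_le h1 h2 hr), hs0.eventually hVe,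
      hs0.eventually him] with n hn hu hi
    have hlog : Complex.log (catU (V (s n))) = s n := by
      rw [hu, Complex.log_exp hi.1 hi.2.le]
    have hval : Complex.exp (-m * (n * s n)) * catPoly (Complex.exp (s n)) n 0 / catGrowth r ^ n -
        catAmp (V (s n)) * catPsi m r (V (s n)) ^ n =
        Complex.exp (-m * (n * s n)) * (catPoly (catU (V (s n))) n 0 -
          catAmp (V (s n)) * catGrowth (V (s n)) ^ n) / catGrowth r ^ n := by
      rw [catPsi, hlog, mul_pow, div_pow, ← Complex.exp_nat_mul, hu,
        show (n : ℂ) * (-m * s n) = -m * (n * s n) by ring]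
      ring
    have hone : ‖Complex.exp (-m * (n * s n))‖ = 1 := by
      rw [Complex.norm_exp]
      simp [hs]
    rw [hval, norm_div, norm_mul, hone, one_mul, norm_pow, div_pow, mul_div_assoc']
    gcongr
    exact hn n
  have hsum := hdiff.add hmain
  rw [zero_add] at hsum
  exact hsum.congr fun n => sub_add_cancel _ _

end Asymptotics

section LimitLaw

open MeasureTheory ProbabilityTheory

lemma gaussianReal_Iic (x : ℝ) : (gaussianReal 0 1).real (Set.Iic x) = gaussianCDF x := by
  rw [Measure.real, gaussianReal_apply_eq_integral 0 one_ne_zero, ENNReal.toReal_ofReal]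
  · simp [gaussianPDFReal, gaussianCDF, integral_const_mul]
  · exact setIntegral_nonneg measurableSet_Iic fun y _ => gaussianPDFReal_nonneg _ _ _

/-- The law of `X` under the uniform distribution on a finite set `S`. -/
noncomputable def empiricalLaw {α : Type*} (S : Finset α) (X : α → ℝ) : Measure ℝ :=
  (S.card : ENNReal)⁻¹ • ∑ l ∈ S, Measure.dirac (X l)

lemma isProbabilityMeasure_empiricalLaw {α : Type*} {S : Finset α} (hS : S.Nonempty) (X : α → ℝ) :
    IsProbabilityMeasure (empiricalLaw S X) := by
  constructor
  simp [empiricalLaw]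
  exact ENNReal.inv_mul_cancel (by exact_mod_cast hS.card_pos.ne') (ENNReal.natCast_ne_top _)

lemma empiricalLaw_real_Iic {α : Type*} (S : Finset α) (X : α → ℝ) (x : ℝ) :
    (empiricalLaw S X).real (Set.Iic x) = ((S.filter fun l => X l ≤ x).card : ℝ) / S.card := by
  rw [Measure.real, empiricalLaw, Measure.smul_apply, Measure.finsetSum_apply]
  simp [Set.indicator_apply, div_eq_inv_mul, Finset.sum_boole]

lemma charFun_empiricalLaw {α : Type*} (S : Finset α) (X : α → ℝ) (t : ℝ) :
    charFun (empiricalLaw S X) t = (∑ l ∈ S, Complex.exp (t * X l * Complex.I)) / S.card := by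
  rw [charFun_apply_real, empiricalLaw, integral_smul_measure, integral_finsetSum_measure]
  · simp [div_eq_inv_mul]
  · intro i _
    exact integrable_dirac (by simp)

theorem tendsto_card_filter_le_gaussianCDF {α : Type*} (S : ℕ → Finset α) (X : ℕ → α → ℝ)
    (h : ∀ t : ℝ, Tendsto (fun n => (∑ l ∈ S n, Complex.exp (t * X n l * Complex.I)) / (S n).card)
      atTop (𝓝 (Complex.exp (-t ^ 2 / 2)))) (x : ℝ) :
    Tendsto (fun n => (((S n).filter fun l => X n l ≤ x).card : ℝ) / (S n).card) atTop
      (𝓝 (gaussianCDF x)) := by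
  have hS : ∀ᶠ n in atTop, (S n).Nonempty := by
    filter_upwards [(h 0).eventually_ne (Complex.exp_ne_zero _)] with n hn
    rw [Finset.nonempty_iff_ne_empty]
    rintro he
    simp [he] at hn
  obtain ⟨N, hN⟩ := eventually_atTop.1 hS
  let ν : ℕ → ProbabilityMeasure ℝ := fun n =>
    ⟨empiricalLaw (S (n + N)) (X (n + N)),
      isProbabilityMeasure_empiricalLaw (hN _ (Nat.le_add_left _ _)) _⟩
  let γ : ProbabilityMeasure ℝ := ⟨gaussianReal 0 1, inferInstance⟩
  have hν : Tendsto ν atTop (𝓝 γ) := by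
    refine ProbabilityMeasure.tendsto_of_tendsto_charFun fun t => ?_
    have h1 := (tendsto_add_atTop_iff_nat N).2 (h t)
    have h2 : charFun (γ : Measure ℝ) t = Complex.exp (-t ^ 2 / 2) := by
      simp [γ, charFun_gaussianReal, neg_div]
    rw [h2]
    exact h1.congr fun n => (charFun_empiricalLaw _ _ t).symm
  have hfr : (γ : Measure ℝ) (frontier (Set.Iic x)) = 0 := by
    have : NullSingletonClass (gaussianReal 0 1) := nullSingletonClass_gaussianReal one_ne_zero
    rw [frontier_Iic]
    change gaussianReal 0 1 {x} = 0
    exact measure_singleton x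
  have h3 := ProbabilityMeasure.tendsto_measure_of_null_frontier_of_tendsto' hν hfr
  have h4 := (ENNReal.tendsto_toReal (measure_ne_top (γ : Measure ℝ) (Set.Iic x))).comp h3
  refine (tendsto_add_atTop_iff_nat N).1 ?_
  rw [← gaussianReal_Iic]
  exact h4.congr fun n => empiricalLaw_real_Iic _ _ x

end LimitLaw

lemma catPoly_one (n : ℕ) : catPoly 1 n 0 = (catPaths n 0).card := by
  simp [catPoly]

lemma natCard_dyckCat (n : ℕ) (P : List ℤ → Prop) [DecidablePred P] :
    Nat.card {l : List ℤ // DyckCat n l ∧ P l} = ((catPaths n 0).filter P).card :=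
  Nat.subtype_card _ fun l => by simp [dyckCat_iff]

lemma sum_exp_eq_catPoly (n : ℕ) (t μ σ : ℝ) (hσ : σ ≠ 0) (hn : 0 < n) :
    ∑ l ∈ catPaths n 0,
      Complex.exp (t * (((catSizeSum dyckJ 0 l - μ * n) / (σ * √n) : ℝ) : ℂ) * Complex.I) =
    Complex.exp (-μ * (n * (((t / σ / √n : ℝ) : ℂ) * Complex.I))) *
      catPoly (Complex.exp (((t / σ / √n : ℝ) : ℂ) * Complex.I)) n 0 := by
  have hn' : (√n : ℂ) ≠ 0 := by
    exact_mod_cast (Real.sqrt_pos.2 (by exact_mod_cast hn)).ne'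
  have hσ' : (σ : ℂ) ≠ 0 := by exact_mod_cast hσ
  rw [catPoly, Finset.mul_sum]
  refine Finset.sum_congr rfl fun l _ => ?_
  rw [← Complex.exp_int_mul, ← Complex.exp_add]
  congr 1
  push_cast
  field_simp
  ring

/-- **Gaussian limit law for the cumulative size of catastrophes.** Let `μ` be
the unique real root of `31μ³ + 62μ² + 71μ - 27` and `σ > 0` the unique
positive real root of `29791σ⁶ - 59582σ⁴ + 298411σ² - 159099`. For every real
`x`, the fraction of Dyck paths with catastrophes of length `n` whose
cumulative size of catastrophes is at most `μn + σ√n·x` tends to `Φ(x)`. -/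
theorem catSizeSum_gaussian (μ σ : ℝ)
    (hμ : 31 * μ ^ 3 + 62 * μ ^ 2 + 71 * μ - 27 = 0) (hσpos : 0 < σ)
    (hσ : 29791 * σ ^ 6 - 59582 * σ ^ 4 + 298411 * σ ^ 2 - 159099 = 0) (x : ℝ) :
    Tendsto (fun n : ℕ =>
        (Nat.card {l : List ℤ // DyckCat n l ∧
            (catSizeSum dyckJ 0 l : ℝ) ≤ μ * n + σ * Real.sqrt n * x} : ℝ) /
          (eCount n : ℝ))
      atTop (𝓝 (gaussianCDF x)) := by
  obtain ⟨r, h1, h2, hr⟩ := exists_catRoot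
  have hm := mean_eq hμ hr
  have hv := variance_eq hσ hr
  have hA := catAmp_root_ne_zero h1 h2 hr
  have hgrow := lt_norm_catGrowth_root h1 h2 hr
  have hg0 : catGrowth r ≠ 0 := norm_pos_iff.1 (by linarith)
  have hden : Tendsto (fun n : ℕ => ((catPaths n 0).card : ℂ) / catGrowth r ^ n) atTop
      (𝓝 (catAmp r)) := by
    simpa [catPoly_one] using tendsto_catPoly h1 h2 hr hm 0
  have key := tendsto_card_filter_le_gaussianCDF (fun n => catPaths n 0)
    (fun n l => (catSizeSum dyckJ 0 l - μ * n) / (σ * √n)) (fun t => ?_) x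
  · refine key.congr' ?_
    filter_upwards [eventually_gt_atTop 0] with n hn
    have hpos : 0 < σ * √n := mul_pos hσpos (Real.sqrt_pos.2 (by exact_mod_cast hn))
    have hall := natCard_dyckCat n fun _ => True
    simp only [and_true, Finset.filter_true] at hall
    rw [natCard_dyckCat, eCount, hall]
    simp only [div_le_iff₀ hpos, sub_le_iff_le_add, mul_comm x, add_comm (σ * √n * x)]
  · have h3 := (tendsto_catPoly h1 h2 hr hm (t / σ)).div hden hA
    have hlim : catAmp r *
        Complex.exp (((-88 + 1693 * r - 1093 * r ^ 2) / 961 : ℝ) * -(t / σ : ℝ) ^ 2 / 2) /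
        catAmp r = Complex.exp (-t ^ 2 / 2) := by
      rw [mul_div_cancel_left₀ _ hA, ← hv]
      have hσ' : (σ : ℂ) ≠ 0 := by exact_mod_cast hσpos.ne'
      congr 1
      push_cast
      field_simp
    rw [hlim] at h3
    refine h3.congr' ?_
    filter_upwards [eventually_gt_atTop 0] with n hn
    rw [sum_exp_eq_catPoly n t μ σ hσpos.ne' hn, Pi.div_apply,
      div_div_div_cancel_right₀ (pow_ne_zero _ hg0)]
end

section
/- Let ρ0 be the unique positive real root of x³ + 2x² + x − 1 and, for k ≥ 1, let q_k be the number of Dyck paths with catastrophes of length k containing exactly one catastrophe, occurring as the final step. Then the waiting time for the first catastrophe admits a discrete limit law: for every fixed k ≥ 1, the fraction of Dyck paths with catastrophes of length n whose first catastrophe occurs exactly at step k (i.e., among all e_n such paths) tends, as n → ∞, to q_k · ρ0ᵏ. -/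
open Filter Topology

/-- The number of catastrophe steps of a path starting at altitude `h`. -/
def catNum (J : Finset ℤ) : ℤ → List ℤ → ℕ
  | _, [] => 0
  | h, s :: r => (if s = -h ∧ 0 < h ∧ -h ∉ J then 1 else 0) + catNum J (h + s) r

/-- `q k`: the number of Dyck paths with catastrophes of length `k` containing
exactly one catastrophe, occurring as the final step. -/
noncomputable def qCount (k : ℕ) : ℕ :=
  Nat.card {l : List ℤ //
    l.length = k ∧ CatValidFrom dyckJ 0 l ∧ l.sum = 0 ∧
      ∃ l' : List ℤ, l = l' ++ [-l'.sum] ∧ 0 < l'.sum ∧ -l'.sum ∉ dyckJ ∧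
        catNum dyckJ 0 l' = 0}

/-- The first catastrophe of `l` occurs exactly at step `k` (1-indexed): the
prefix of length `k - 1` contains no catastrophe and the prefix of length `k`
contains one. -/
def FirstCatAt (l : List ℤ) (k : ℕ) : Prop :=
  catNum dyckJ 0 (l.take (k - 1)) = 0 ∧ catNum dyckJ 0 (l.take k) = 1

section Enumeration

theorem catValidFrom_append (J : Finset ℤ) (h : ℤ) (a b : List ℤ) :
    CatValidFrom J h (a ++ b) ↔ CatValidFrom J h a ∧ CatValidFrom J (h + a.sum) b := by
  induction a generalizing h with
  | nil => simp [CatValidFrom]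
  | cons s r ih => simp [CatValidFrom, ih, and_assoc, add_assoc]

theorem catNum_append (J : Finset ℤ) (h : ℤ) (a b : List ℤ) :
    catNum J h (a ++ b) = catNum J h a + catNum J (h + a.sum) b := by
  induction a generalizing h with
  | nil => simp [catNum]
  | cons s r ih => simp [catNum, ih, add_assoc]

/-- The Dyck paths with catastrophes of length `n` from altitude `h` to altitude `0`. -/
def pathsToZero : ℕ → ℕ → Finset (List ℤ)
  | 0, 0 => {[]}
  | 0, _ + 1 => ∅
  | n + 1, 0 => (pathsToZero n 1).image (List.cons 1)
  | n + 1, 1 =>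
    (pathsToZero n 2).image (List.cons 1) ∪ (pathsToZero n 0).image (List.cons (-1))
  | n + 1, h + 2 =>
    (pathsToZero n (h + 3)).image (List.cons 1) ∪
      (pathsToZero n (h + 1)).image (List.cons (-1)) ∪
      (pathsToZero n 0).image (List.cons (-(h + 2 : ℤ)))

theorem mem_pathsToZero (n h : ℕ) (l : List ℤ) :
    l ∈ pathsToZero n h ↔ l.length = n ∧ CatValidFrom dyckJ h l ∧ (h : ℤ) + l.sum = 0 := by
  induction n generalizing h l with
  | zero =>
    cases h with
    | zero => cases l <;> simp [pathsToZero, CatValidFrom]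
    | succ h =>
      cases l with
      | nil => simp [pathsToZero, CatValidFrom]; omega
      | cons s r => simp [pathsToZero]
  | succ n ih =>
    cases l with
    | nil => rcases h with _ | _ | h <;> simp [pathsToZero]
    | cons s r =>
      have hstep : CatValidFrom dyckJ h (s :: r) ↔
          (s = 1 ∧ CatValidFrom dyckJ ((h + 1 : ℕ) : ℤ) r) ∨
          (s = -1 ∧ 1 ≤ h ∧ CatValidFrom dyckJ ((h - 1 : ℕ) : ℤ) r) ∨
          (s = -(h : ℤ) ∧ 2 ≤ h ∧ CatValidFrom dyckJ ((0 : ℕ) : ℤ) r) := by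
        simp only [CatValidFrom, dyckJ, Finset.mem_insert, Finset.mem_singleton]
        constructor
        · rintro ⟨⟨rfl | rfl, h1⟩ | ⟨rfl, h1, h2⟩, hr⟩
          · refine Or.inr (Or.inl ⟨rfl, by omega, ?_⟩)
            rwa [Nat.cast_sub (by omega)]
          · exact Or.inl ⟨rfl, by simpa using hr⟩
          · exact Or.inr (Or.inr ⟨rfl, by omega, by simpa using hr⟩)
        · rintro (⟨rfl, hr⟩ | ⟨rfl, h1, hr⟩ | ⟨rfl, h1, hr⟩)
          · exact ⟨Or.inl ⟨by simp, by omega⟩, by simpa using hr⟩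
          · rw [Nat.cast_sub (by omega)] at hr
            exact ⟨Or.inl ⟨by simp, by omega⟩, hr⟩
          · exact ⟨Or.inr ⟨rfl, by omega, by omega⟩, by simpa using hr⟩
      rw [hstep]
      rcases h with _ | _ | h
      · simp only [pathsToZero, Finset.mem_image, ih, List.cons.injEq, List.length_cons,
          List.sum_cons]
        constructor
        · rintro ⟨a, ⟨h1, h2, h3⟩, rfl, rfl⟩
          exact ⟨by omega, Or.inl ⟨rfl, h2⟩, by push_cast at h3 ⊢; omega⟩
        · rintro ⟨h1, ⟨rfl, h2⟩ | ⟨rfl, h2, h3⟩ | ⟨rfl, h2, h3⟩, h4⟩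
          · exact ⟨r, ⟨by omega, h2, by push_cast at h4 ⊢; omega⟩, rfl, rfl⟩
          all_goals omega
      · simp only [pathsToZero, Finset.mem_image, Finset.mem_union, ih, List.cons.injEq,
          List.length_cons, List.sum_cons]
        constructor
        · rintro (⟨a, ⟨h1, h2, h3⟩, rfl, rfl⟩ | ⟨a, ⟨h1, h2, h3⟩, rfl, rfl⟩)
          · exact ⟨by omega, Or.inl ⟨rfl, h2⟩, by push_cast at h3 ⊢; omega⟩
          · exact ⟨by omega, Or.inr (Or.inl ⟨rfl, by omega, h2⟩), by push_cast at h3 ⊢; omega⟩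
        · rintro ⟨h1, ⟨rfl, h2⟩ | ⟨rfl, h2, h3⟩ | ⟨rfl, h2, h3⟩, h4⟩
          · exact Or.inl ⟨r, ⟨by omega, h2, by push_cast at h4 ⊢; omega⟩, rfl, rfl⟩
          · exact Or.inr ⟨r, ⟨by omega, h3, by push_cast at h4 ⊢; omega⟩, rfl, rfl⟩
          · omega
      · simp only [pathsToZero, Finset.mem_image, Finset.mem_union, ih, List.cons.injEq,
          List.length_cons, List.sum_cons]
        constructor
        · rintro ((⟨a, ⟨h1, h2, h3⟩, rfl, rfl⟩ | ⟨a, ⟨h1, h2, h3⟩, rfl, rfl⟩) |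
            ⟨a, ⟨h1, h2, h3⟩, rfl, rfl⟩)
          · exact ⟨by omega, Or.inl ⟨rfl, h2⟩, by push_cast at h3 ⊢; omega⟩
          · exact ⟨by omega, Or.inr (Or.inl ⟨rfl, by omega, h2⟩), by push_cast at h3 ⊢; omega⟩
          · exact ⟨by omega, Or.inr (Or.inr ⟨by push_cast; omega, by omega, h2⟩),
              by push_cast at h3 ⊢; omega⟩
        · rintro ⟨h1, ⟨rfl, h2⟩ | ⟨rfl, h2, h3⟩ | ⟨rfl, h2, h3⟩, h4⟩
          · exact Or.inl (Or.inl ⟨r, ⟨by omega, h2, by push_cast at h4 ⊢; omega⟩, rfl, rfl⟩)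
          · exact Or.inl (Or.inr ⟨r, ⟨by omega, h3, by push_cast at h4 ⊢; omega⟩, rfl, rfl⟩)
          · exact Or.inr ⟨r, ⟨by omega, h3, by push_cast at h4 ⊢; omega⟩,
              by push_cast; omega, rfl⟩

theorem card_image_cons (s : ℤ) (A : Finset (List ℤ)) :
    (A.image (List.cons s)).card = A.card :=
  Finset.card_image_of_injective _ (List.cons_injective)

theorem disjoint_image_cons {s t : ℤ} (hst : s ≠ t) (A B : Finset (List ℤ)) :
    Disjoint (A.image (List.cons s)) (B.image (List.cons t)) := by
  rw [Finset.disjoint_left]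
  intro l hl hl'
  obtain ⟨a, -, rfl⟩ := Finset.mem_image.1 hl
  obtain ⟨b, -, hb⟩ := Finset.mem_image.1 hl'
  exact hst (List.cons.inj hb).1.symm

theorem card_pathsToZero_succ_zero (n : ℕ) :
    (pathsToZero (n + 1) 0).card = (pathsToZero n 1).card := by
  rw [pathsToZero, card_image_cons]

theorem card_pathsToZero_succ_one (n : ℕ) :
    (pathsToZero (n + 1) 1).card = (pathsToZero n 2).card + (pathsToZero n 0).card := by
  rw [pathsToZero, Finset.card_union_of_disjoint (disjoint_image_cons (by norm_num) _ _),
    card_image_cons, card_image_cons]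

theorem card_pathsToZero_succ_add_two (n h : ℕ) :
    (pathsToZero (n + 1) (h + 2)).card =
      (pathsToZero n (h + 3)).card + (pathsToZero n (h + 1)).card + (pathsToZero n 0).card := by
  rw [pathsToZero, Finset.card_union_of_disjoint,
    Finset.card_union_of_disjoint (disjoint_image_cons (by norm_num) _ _),
    card_image_cons, card_image_cons, card_image_cons]
  rw [Finset.disjoint_union_left]
  exact ⟨disjoint_image_cons (by omega) _ _, disjoint_image_cons (by omega) _ _⟩

theorem eCount_eq_card_pathsToZero (n : ℕ) : eCount n = (pathsToZero n 0).card := by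
  rw [eCount]
  refine Nat.subtype_card _ fun l => ?_
  simp [DyckCat, mem_pathsToZero]

end Enumeration

section Decomposition

theorem catNum_concat_eq_one_iff (l : List ℤ) (s : ℤ) (hl : catNum dyckJ 0 l = 0) :
    catNum dyckJ 0 (l ++ [s]) = 1 ↔ s = -l.sum ∧ 0 < l.sum ∧ -l.sum ∉ dyckJ := by
  simp only [catNum_append, hl, catNum, zero_add, add_zero]
  split_ifs with h <;> simp [h]

theorem card_dyckCat_firstCatAt (n k : ℕ) (hk : 1 ≤ k) (hkn : k ≤ n) :
    Nat.card {l : List ℤ // DyckCat n l ∧ FirstCatAt l k} = qCount k * eCount (n - k) := by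
  rw [qCount, eCount, ← Nat.card_prod]
  have split (l : List ℤ) (hl : DyckCat n l ∧ FirstCatAt l k) :
      ((l.take k).length = k ∧ CatValidFrom dyckJ 0 (l.take k) ∧ (l.take k).sum = 0 ∧
        ∃ l' : List ℤ, l.take k = l' ++ [-l'.sum] ∧ 0 < l'.sum ∧ -l'.sum ∉ dyckJ ∧
          catNum dyckJ 0 l' = 0) ∧ DyckCat (n - k) (l.drop k) := by
    obtain ⟨⟨hlen, hval, hsum⟩, hc0, hc1⟩ := hl
    have hlt : k - 1 < l.length := by omega
    have hcons : l.take k = l.take (k - 1) ++ [l[k - 1]] := by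
      rw [List.take_concat_get' l (k - 1) hlt, Nat.sub_add_cancel hk]
    rw [hcons, catNum_concat_eq_one_iff _ _ hc0] at hc1
    obtain ⟨hs, hpos, hJ⟩ := hc1
    rw [hs] at hcons
    have hsum0 : (l.take k).sum = 0 := by rw [hcons]; simp
    rw [← List.take_append_drop k l, catValidFrom_append, hsum0] at hval
    rw [← List.take_append_drop k l, List.sum_append, hsum0] at hsum
    refine ⟨⟨by simp; omega, hval.1, hsum0, _, hcons, hpos, hJ, hc0⟩, by simp; omega, ?_, ?_⟩
    · simpa using hval.2
    · simpa using hsum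
  have join (a b : List ℤ) (ha : a.length = k ∧ CatValidFrom dyckJ 0 a ∧ a.sum = 0 ∧
      ∃ l' : List ℤ, a = l' ++ [-l'.sum] ∧ 0 < l'.sum ∧ -l'.sum ∉ dyckJ ∧
        catNum dyckJ 0 l' = 0) (hb : DyckCat (n - k) b) :
      DyckCat n (a ++ b) ∧ FirstCatAt (a ++ b) k := by
    obtain ⟨hlen, hval, hsum, l', ha, hpos, hJ, hc0⟩ := ha
    obtain ⟨hblen, hbval, hbsum⟩ := hb
    have hl' : l'.length = k - 1 := by rw [← hlen, ha]; simp
    refine ⟨⟨by simp; omega, ?_, by simp [hsum, hbsum]⟩, ?_, ?_⟩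
    · rw [catValidFrom_append, hsum]
      exact ⟨hval, by simpa using hbval⟩
    · rw [List.take_append_of_le_length (by omega), ha, List.take_left' hl', hc0]
    · rw [List.take_left' hlen, ha, catNum_concat_eq_one_iff _ _ hc0]
      exact ⟨rfl, hpos, hJ⟩
  exact Nat.card_congr
    { toFun := fun l => ⟨⟨l.1.take k, (split l.1 l.2).1⟩, ⟨l.1.drop k, (split l.1 l.2).2⟩⟩
      invFun := fun p => ⟨p.1.1 ++ p.2.1, join p.1.1 p.2.1 p.1.2 p.2.2⟩
      left_inv := fun l => Subtype.ext (List.take_append_drop k l.1)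
      right_inv := by
        rintro ⟨⟨a, hlen, ha⟩, ⟨b, hb⟩⟩
        simp [List.take_left' hlen, List.drop_left' hlen] }

end Decomposition

section GeneratingFunction

open PowerSeries

/-- The coefficients of the power series solution of `W = X * (1 + W ^ 2)`. -/
def kernelCoeff : ℕ → ℕ
  | 0 => 0
  | n + 1 => (if n = 0 then 1 else 0) +
      ∑ i : Fin (n + 1), kernelCoeff i * kernelCoeff (n - i)

/-- The power series solution of `W = X * (1 + W ^ 2)`. -/
noncomputable def kernelSeries : ℝ⟦X⟧ := PowerSeries.mk fun n => (kernelCoeff n : ℝ)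

theorem kernelCoeff_succ (n : ℕ) :
    kernelCoeff (n + 1) = (if n = 0 then 1 else 0) +
      ∑ p ∈ Finset.HasAntidiagonal.antidiagonal n, kernelCoeff p.1 * kernelCoeff p.2 := by
  rw [kernelCoeff, Finset.Nat.sum_antidiagonal_eq_sum_range_succ
    (fun i j => kernelCoeff i * kernelCoeff j), Finset.sum_range]

theorem kernelSeries_eq : kernelSeries = X * (1 + kernelSeries ^ 2) := by
  ext n
  cases n with
  | zero => simp [kernelSeries, kernelCoeff]
  | succ n =>
    rw [coeff_succ_X_mul, map_add, sq, coeff_mul, coeff_one]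
    simp [kernelSeries, kernelCoeff_succ]

/-- The generating function of the paths from altitude `h` to altitude `0`. -/
noncomputable def pathSeries (h : ℕ) : ℝ⟦X⟧ :=
  PowerSeries.mk fun n => ((pathsToZero n h).card : ℝ)

theorem pathSeries_zero : pathSeries 0 = 1 + X * pathSeries 1 := by
  ext n
  cases n with
  | zero => simp [pathSeries, pathsToZero]
  | succ n =>
    rw [map_add, coeff_succ_X_mul, coeff_one]
    simp [pathSeries, card_pathsToZero_succ_zero]

theorem pathSeries_one : pathSeries 1 = X * (pathSeries 2 + pathSeries 0) := by
  ext n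
  cases n with
  | zero => simp [pathSeries, pathsToZero]
  | succ n =>
    rw [coeff_succ_X_mul]
    simp [pathSeries, card_pathsToZero_succ_one]

theorem pathSeries_add_two (h : ℕ) :
    pathSeries (h + 2) = X * (pathSeries (h + 3) + pathSeries (h + 1) + pathSeries 0) := by
  ext n
  cases n with
  | zero => simp [pathSeries, pathsToZero]
  | succ n =>
    rw [coeff_succ_X_mul]
    simp [pathSeries, card_pathsToZero_succ_add_two]

theorem eq_zero_of_eq_X_mul {R : Type*} [CommRing R] (Z : ℕ → R⟦X⟧) (h0 : Z 0 = 0)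
    (hZ : ∀ h, Z (h + 1) = X * (Z (h + 2) + Z h)) (h : ℕ) : Z h = 0 := by
  ext n
  induction n generalizing h with
  | zero =>
    cases h with
    | zero => simp [h0]
    | succ h => simp [hZ h]
  | succ n ih =>
    cases h with
    | zero => simp [h0]
    | succ h => rw [hZ h, coeff_succ_X_mul, map_add, ih, ih]; simp

theorem pathSeries_three_sub_two :
    pathSeries 3 - pathSeries 2 = (pathSeries 2 - pathSeries 1) * kernelSeries := by
  have key := eq_zero_of_eq_X_mul
    (fun h => pathSeries (h + 2) - pathSeries (h + 1) -
      (pathSeries 2 - pathSeries 1) * kernelSeries ^ h) (by simp)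
    (fun h => by
      linear_combination pathSeries_add_two (h + 1) - pathSeries_add_two h -
        (pathSeries 2 - pathSeries 1) * kernelSeries ^ h * kernelSeries_eq) 1
  linear_combination key

theorem pathSeries_zero_mul :
    pathSeries 0 * (1 - X - 2 * X ^ 2 - X ^ 3) = 1 - X - X ^ 2 - X ^ 2 * kernelSeries := by
  set W := kernelSeries with hW
  have hM : (1 - X - 2 * X ^ 2 - X * W + X ^ 2 * W + X ^ 3 * W : ℝ⟦X⟧) ≠ 0 := by
    intro h
    simpa using congrArg constantCoeff h
  have hE : pathSeries 0 * (1 - X - 2 * X ^ 2 - X * W + X ^ 2 * W + X ^ 3 * W) =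
      1 - X - X * W - X ^ 2 + X ^ 2 * W := by
    linear_combination (1 - X - X * W - X ^ 2 + X ^ 2 * W) * pathSeries_zero +
      X * (1 - X - X * W) * pathSeries_one + X ^ 2 * pathSeries_add_two 0 +
      X ^ 3 * pathSeries_three_sub_two
  apply mul_right_cancel₀ hM
  linear_combination (1 - X - 2 * X ^ 2 - X ^ 3) * hE +
    X ^ 2 * (1 - X - X ^ 2) * kernelSeries_eq

theorem eCount_add_three (n : ℕ) :
    (eCount (n + 3) : ℝ) =
      eCount (n + 2) + 2 * eCount (n + 1) + eCount n - kernelCoeff (n + 1) := by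
  have h := congrArg (coeff (n + 3)) pathSeries_zero_mul
  have e1 : pathSeries 0 * (1 - X - 2 * X ^ 2 - X ^ 3) =
      pathSeries 0 - X ^ 1 * pathSeries 0 - C 2 * (X ^ 2 * pathSeries 0) -
        X ^ 3 * pathSeries 0 := by
    rw [map_ofNat]; ring
  rw [e1] at h
  simp only [map_sub, coeff_C_mul, coeff_X_pow_mul', coeff_one, coeff_X, coeff_X_pow] at h
  simp [pathSeries, kernelSeries, ← eCount_eq_card_pathsToZero] at h
  linarith

end GeneratingFunction

section Asymptotics

theorem tendsto_zero_of_le_mul_add {s ε : ℕ → ℝ} {c : ℝ} (hs : ∀ n, 0 ≤ s n) (hc0 : 0 ≤ c)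
    (hc1 : c < 1) (hε : Tendsto ε atTop (𝓝 0)) (h : ∀ n, s (n + 1) ≤ c * s n + ε n) :
    Tendsto s atTop (𝓝 0) := by
  rw [Metric.tendsto_atTop]
  intro δ hδ
  obtain ⟨N, hN⟩ := eventually_atTop.1
    (hε.eventually_le_const (show 0 < δ / 2 * (1 - c) by nlinarith))
  have hb : ∀ j, s (N + j) ≤ c ^ j * s N + δ / 2 := by
    intro j
    induction j with
    | zero => simp; linarith
    | succ j ih =>
      have h1 := h (N + j)
      have h2 := hN (N + j) (by omega)
      have h3 := mul_le_mul_of_nonneg_left ih hc0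
      rw [← add_assoc, pow_succ]
      linarith
  have ht : Tendsto (fun j => c ^ j * s N) atTop (𝓝 0) := by
    simpa using (tendsto_pow_atTop_nhds_zero_of_lt_one hc0 hc1).mul_const (s N)
  obtain ⟨M, hM⟩ := eventually_atTop.1 (ht.eventually_lt_const (half_pos hδ))
  refine ⟨N + M, fun n hn => ?_⟩
  obtain ⟨j, rfl⟩ : ∃ j, n = N + j := ⟨n - N, by omega⟩
  rw [Real.dist_eq, sub_zero, abs_of_nonneg (hs _)]
  linarith [hb j, hM j (by omega)]

variable {ρ : ℝ}

theorem root_lt_half (hρ : ρ ^ 3 + 2 * ρ ^ 2 + ρ - 1 = 0) : ρ < 1 / 2 := by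
  by_contra! h
  nlinarith [mul_nonneg (sub_nonneg.2 h) (sq_nonneg ρ),
    mul_nonneg (sub_nonneg.2 h) (sub_nonneg.2 h)]

theorem sum_range_sum_antidiagonal_le (f : ℕ → ℝ) (hf : ∀ i, 0 ≤ f i) (n : ℕ) :
    ∑ i ∈ Finset.range n, ∑ p ∈ Finset.HasAntidiagonal.antidiagonal i, f p.1 * f p.2 ≤
      (∑ i ∈ Finset.range n, f i) ^ 2 := by
  rw [sq, Finset.sum_mul_sum, ← Finset.sum_product']
  refine le_trans (le_of_eq (Finset.sum_congr rfl fun i hi => Finset.sum_congr ?_ fun _ _ => rfl))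
    (Finset.sum_fiberwise_le_sum_of_sum_fiber_nonneg (t := Finset.range n)
      (g := fun p : ℕ × ℕ => p.1 + p.2)
      fun _ _ => Finset.sum_nonneg fun p _ => mul_nonneg (hf p.1) (hf p.2))
  ext p
  simp only [Finset.HasAntidiagonal.mem_antidiagonal, Finset.mem_filter, Finset.mem_product,
    Finset.mem_range] at hi ⊢
  omega

theorem sum_kernelCoeff_le (hpos : 0 ≤ ρ) (hρ : ρ ≤ 1 / 2) (n : ℕ) :
    ∑ i ∈ Finset.range n, (kernelCoeff i : ℝ) * ρ ^ i ≤ 1 := by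
  induction n with
  | zero => simp
  | succ n ih =>
    have h0 : ∀ i, 0 ≤ (kernelCoeff i : ℝ) * ρ ^ i := fun i => by positivity
    have hS := Finset.sum_nonneg fun i (_ : i ∈ Finset.range n) => h0 i
    have hle := sum_range_sum_antidiagonal_le _ h0 n
    have hone : ∑ i ∈ Finset.range n, (if i = 0 then (1 : ℝ) else 0) ≤ 1 := by
      rw [Finset.sum_ite_eq']; split_ifs <;> simp
    have hterm : ∀ i, (kernelCoeff (i + 1) : ℝ) * ρ ^ (i + 1) =
        ρ * ((if i = 0 then (1 : ℝ) else 0) +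
          ∑ p ∈ Finset.HasAntidiagonal.antidiagonal i,
            (kernelCoeff p.1 : ℝ) * ρ ^ p.1 * ((kernelCoeff p.2 : ℝ) * ρ ^ p.2)) := by
      intro i
      have hsum : ∑ p ∈ Finset.HasAntidiagonal.antidiagonal i,
            (kernelCoeff p.1 : ℝ) * ρ ^ p.1 * ((kernelCoeff p.2 : ℝ) * ρ ^ p.2) =
          (∑ p ∈ Finset.HasAntidiagonal.antidiagonal i,
            (kernelCoeff p.1 : ℝ) * kernelCoeff p.2) * ρ ^ i := by
        rw [Finset.sum_mul]
        refine Finset.sum_congr rfl fun p hp => ?_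
        rw [← Finset.HasAntidiagonal.mem_antidiagonal.1 hp, pow_add]
        ring
      rw [hsum, kernelCoeff_succ]
      push_cast
      split_ifs with hi
      · subst hi; ring
      · ring
    rw [Finset.sum_range_succ', Finset.sum_congr rfl fun i _ => hterm i, ← Finset.mul_sum,
      Finset.sum_add_distrib]
    simp only [kernelCoeff, Nat.cast_zero, zero_mul, add_zero]
    nlinarith

theorem exists_tendsto_eCount_mul_pow (hpos : 0 < ρ) (hρ : ρ ^ 3 + 2 * ρ ^ 2 + ρ - 1 = 0) :
    ∃ c, 0 < c ∧ Tendsto (fun n => (eCount n : ℝ) * ρ ^ n) atTop (𝓝 c) := by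
  have hhalf := root_lt_half hρ
  set u : ℕ → ℝ := fun n => (eCount n : ℝ) * ρ ^ n with hu
  set L : ℕ → ℝ := fun n => u (n + 2) + (1 - ρ) * u (n + 1) + ρ ^ 3 * u n with hL
  have hL0 : L 0 = ρ ^ 2 + ρ ^ 3 := by
    simp [hL, hu, eCount_eq_card_pathsToZero, pathsToZero]
  have hLsucc : ∀ n, L (n + 1) = L n - ρ ^ 2 * ((kernelCoeff (n + 1) : ℝ) * ρ ^ (n + 1)) := by
    intro n
    simp only [hL, hu, eCount_add_three, add_assoc, Nat.reduceAdd]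
    linear_combination ((eCount (n + 1) : ℝ) * ρ ^ (n + 1)) * hρ
  have hLsum : ∀ n, L n = ρ ^ 2 + ρ ^ 3 -
      ρ ^ 2 * ∑ i ∈ Finset.range (n + 1), (kernelCoeff i : ℝ) * ρ ^ i := by
    intro n
    induction n with
    | zero => simp [hL0, kernelCoeff]
    | succ n ih => rw [hLsucc, ih, Finset.sum_range_succ _ (n + 1)]; ring
  have hLge : ∀ n, ρ ^ 3 ≤ L n := by
    intro n
    rw [hLsum]
    nlinarith [sum_kernelCoeff_le hpos.le hhalf.le (n + 1), sq_nonneg ρ]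
  have hanti : Antitone L := antitone_nat_of_succ_le fun n => by
    rw [hLsucc]
    have : 0 ≤ ρ ^ 2 * ((kernelCoeff (n + 1) : ℝ) * ρ ^ (n + 1)) := by positivity
    linarith
  have hlim := tendsto_atTop_ciInf hanti ⟨ρ ^ 3, by rintro _ ⟨n, rfl⟩; exact hLge n⟩
  set ℓ := ⨅ n, L n
  have hℓ : 0 < ℓ := lt_of_lt_of_le (by positivity) (ge_of_tendsto' hlim hLge)
  have hden : 0 < 2 - ρ + ρ ^ 3 := by nlinarith [pow_pos hpos 3]
  refine ⟨ℓ / (2 - ρ + ρ ^ 3), by positivity, ?_⟩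
  set c := ℓ / (2 - ρ + ρ ^ 3) with hc
  have hcℓ : c * (2 - ρ + ρ ^ 3) = ℓ := div_mul_cancel₀ _ hden.ne'
  have hε : Tendsto (fun n => |L n - ℓ|) atTop (𝓝 0) := by
    simpa using (hlim.sub_const ℓ).abs
  have hs := tendsto_zero_of_le_mul_add (s := fun n => |u (n + 1) - c| + ρ / 2 * |u n - c|)
    (c := 1 - ρ / 2) (fun n => by positivity) (by linarith) (by linarith) hε (fun n => by
      have hv : u (n + 2) - c = (L n - ℓ) - (1 - ρ) * (u (n + 1) - c) - ρ ^ 3 * (u n - c) := by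
        simp only [hL]
        linear_combination (-1 : ℝ) * hcℓ
      have h1 : |u (n + 2) - c| ≤
          |L n - ℓ| + (1 - ρ) * |u (n + 1) - c| + ρ ^ 3 * |u n - c| := by
        rw [hv]
        refine (abs_sub _ _).trans (add_le_add ((abs_sub _ _).trans (add_le_add le_rfl ?_)) ?_)
        · rw [abs_mul, abs_of_nonneg (by linarith : 0 ≤ 1 - ρ)]
        · rw [abs_mul, abs_of_nonneg (by positivity)]
      have h2 : ρ ^ 3 ≤ (1 - ρ / 2) * (ρ / 2) := by nlinarith
      have h3 := mul_le_mul_of_nonneg_right h2 (abs_nonneg (u n - c))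
      simp only [add_assoc, Nat.reduceAdd] at h1 ⊢
      linarith)
  rw [tendsto_iff_dist_tendsto_zero]
  have hs' := hs.const_mul (2 / ρ)
  rw [mul_zero] at hs'
  refine squeeze_zero (fun n => dist_nonneg) (fun n => ?_) hs'
  have h4 : 2 / ρ * (|u (n + 1) - c| + ρ / 2 * |u n - c|) =
      2 / ρ * |u (n + 1) - c| + |u n - c| := by field_simp
  rw [h4, Real.dist_eq]
  have : 0 ≤ 2 / ρ * |u (n + 1) - c| := by positivity
  linarith

end Asymptotics

/-- **Limit law for the waiting time of the first catastrophe.** Let `ρ0` be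
the unique positive real root of `x³ + 2x² + x - 1`. For every fixed `k ≥ 1`,
the fraction of Dyck paths with catastrophes of length `n` whose first
catastrophe occurs exactly at step `k` tends to `q_k · ρ0ᵏ`. -/
theorem firstCatastrophe_limit (ρ0 : ℝ) (hρ0pos : 0 < ρ0)
    (hρ0 : ρ0 ^ 3 + 2 * ρ0 ^ 2 + ρ0 - 1 = 0) (k : ℕ) (hk : 1 ≤ k) :
    Tendsto (fun n : ℕ =>
        (Nat.card {l : List ℤ // DyckCat n l ∧ FirstCatAt l k} : ℝ) / (eCount n : ℝ))
      atTop (𝓝 ((qCount k : ℝ) * ρ0 ^ k)) := by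
  obtain ⟨c, hc, hlim⟩ := exists_tendsto_eCount_mul_pow hρ0pos hρ0
  rw [← tendsto_add_atTop_iff_nat k]
  have hratio := (hlim.div ((tendsto_add_atTop_iff_nat k).2 hlim) hc.ne').const_mul
    ((qCount k : ℝ) * ρ0 ^ k)
  rw [div_self hc.ne', mul_one] at hratio
  refine hratio.congr fun n => ?_
  have hn : ρ0 ^ n ≠ 0 := by positivity
  have hk' : ρ0 ^ k ≠ 0 := by positivity
  rw [card_dyckCat_firstCatAt (n + k) k hk (by omega), Nat.add_sub_cancel]
  push_cast
  simp only [Pi.div_apply]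
  rw [pow_add, mul_comm (ρ0 ^ n), ← mul_assoc, mul_div_mul_right _ _ hn]
  field_simp
end
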